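/- arXiv:2204.11199 — 7 statements merged into one kernel-verified Lean document; each statement's English description precedes it below -/
import Mathlib

section
/- Let G be a finitely generated abelian group and let g₁, g₂ ∈ G be elements such that the quotient groups G/⟨g₁⟩ and G/⟨g₂⟩ are isomorphic. Then there exists an automorphism of G sending g₁ to g₂. -/
/-- If the numbers of elements of `s` and `t` lying below each level agree, then so do the
numbers of elements lying exactly at each level. -/
lemma card_filter_eq_of_card_filter_le {A L : Type*} [PartialOrder L] [Finite L]
    (s t : Finset A) (r : A → L) [DecidableEq L] [DecidableLE L]
    (h : ∀ k, (s.filter (r · ≤ k)).card = (t.filter (r · ≤ k)).card) (k : L) :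
    (s.filter (r · = k)).card = (t.filter (r · = k)).card := by
  classical
  have := Fintype.ofFinite L
  induction k using WellFoundedLT.induction with
  | ind k ih =>
    have split (u : Finset A) : (u.filter (r · ≤ k)).card =
        (u.filter (r · = k)).card + ∑ j with j < k, (u.filter (r · = j)).card := by
      have hlt : (u.filter (r · < k)).card = ∑ j with j < k, (u.filter (r · = j)).card := by
        rw [Finset.card_eq_sum_card_fiberwise (f := r) (t := Finset.univ.filter (· < k))
          (fun a ha => by simpa using (Finset.mem_filter.1 ha).2)]
        refine Finset.sum_congr rfl fun j hj => ?_
        congr 1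
        ext a
        have := (Finset.mem_filter.1 hj).2
        simp only [Finset.mem_filter]
        constructor
        · rintro ⟨⟨h₁, -⟩, h₂⟩
          exact ⟨h₁, h₂⟩
        · rintro ⟨h₁, rfl⟩
          exact ⟨⟨h₁, this⟩, rfl⟩
      rw [← hlt, ← Finset.card_union_of_disjoint]
      · congr 1
        ext a
        simp only [Finset.mem_filter, Finset.mem_union, le_iff_eq_or_lt]
        tauto
      · exact Finset.disjoint_filter.2 fun a _ h₁ h₂ => h₂.ne h₁
    have hk := h k
    rw [split, split, Finset.sum_congr rfl fun j hj => ih j (Finset.mem_filter.1 hj).2] at hk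
    exact Nat.add_right_cancel hk

lemma addSubgroup_eq_of_card_eq {C : Type*} [AddCommGroup C] [IsAddCyclic C] [Finite C]
    {K L : AddSubgroup C} (h : Nat.card K = Nat.card L) : K = L := by
  classical
  have := Fintype.ofFinite C
  have key (M : AddSubgroup C) : Finset.univ.filter (· ∈ M) =
      Finset.univ.filter fun x : C => Nat.card M • x = 0 := by
    refine Finset.eq_of_subset_of_card_le (fun x hx => ?_) ?_
    · simp only [Finset.mem_filter, Finset.mem_univ, true_and] at hx ⊢
      exact congrArg Subtype.val (card_nsmul_eq_zero' (x := (⟨x, hx⟩ : M)))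
    · refine (IsAddCyclic.card_nsmul_eq_zero_le Nat.card_pos).trans_eq ?_
      rw [Nat.card_eq_fintype_card, Fintype.card_subtype]
  ext x
  have hKL : Finset.univ.filter (· ∈ K) = Finset.univ.filter (· ∈ L) := by
    rw [key K, key L, h]
  simpa using Finset.ext_iff.1 hKL x

lemma AddMonoidHom.finite_of_fg (G H : Type*) [AddCommGroup G] [AddGroup.FG G] [AddCommGroup H]
    [Finite H] : Finite (G →+ H) := by
  obtain ⟨S, hS⟩ := AddGroup.fg_def.1 (inferInstance : AddGroup.FG G)
  refine Finite.of_injective (fun (φ : G →+ H) (s : S) => φ s) fun φ ψ h => ?_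
  exact AddMonoidHom.eq_of_eqOn_dense hS fun x hx => congrFun h ⟨x, hx⟩

/-- Homomorphisms out of `G ⧸ ⟨g⟩` are the homomorphisms out of `G` killing `g`. -/
def quotientZMultiplesHomEquiv {G : Type*} [AddCommGroup G] (g : G) (H : Type*)
    [AddCommGroup H] : ((G ⧸ AddSubgroup.zmultiples g) →+ H) ≃ {φ : G →+ H // φ g = 0} where
  toFun χ := ⟨χ.comp (QuotientAddGroup.mk' _), by
    simp [(QuotientAddGroup.eq_zero_iff g).2 (AddSubgroup.mem_zmultiples g)]⟩
  invFun φ := QuotientAddGroup.lift _ φ.1 (by simpa using φ.2)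
  left_inv χ := by
    ext x
    rfl
  right_inv φ := by
    ext x
    rfl

section IsomorphicQuotients

variable {G : Type*} [AddCommGroup G] {g₁ g₂ : G}

lemma card_hom_killing_eq
    (h : Nonempty ((G ⧸ AddSubgroup.zmultiples g₁) ≃+ (G ⧸ AddSubgroup.zmultiples g₂)))
    (H : Type*) [AddCommGroup H] :
    Nat.card {φ : G →+ H // φ g₁ = 0} = Nat.card {φ : G →+ H // φ g₂ = 0} := by
  obtain ⟨e⟩ := h
  exact Nat.card_congr ((quotientZMultiplesHomEquiv g₁ H).symm.trans
    ((e.addMonoidHomCongrLeftEquiv).trans (quotientZMultiplesHomEquiv g₂ H)))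

variable [AddGroup.FG G]

lemma exists_hom_zmod_apply_eq
    (h : Nonempty ((G ⧸ AddSubgroup.zmultiples g₁) ≃+ (G ⧸ AddSubgroup.zmultiples g₂)))
    (n : ℕ) [NeZero n] (φ : G →+ ZMod n) : ∃ ψ : G →+ ZMod n, ψ g₂ = φ g₁ := by
  have := AddMonoidHom.finite_of_fg G (ZMod n)
  let E (g : G) : (G →+ ZMod n) →+ ZMod n := AddMonoidHom.eval g
  have hker : Nat.card (E g₁).ker = Nat.card (E g₂).ker := card_hom_killing_eq h (ZMod n)
  have hmul (g : G) : Nat.card (E g).range * Nat.card (E g).ker = Nat.card (G →+ ZMod n) := by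
    rw [← AddSubgroup.index_ker, mul_comm, AddSubgroup.card_mul_index]
  have hrange : Nat.card (E g₁).range = Nat.card (E g₂).range := by
    have := hmul g₁
    rw [← hmul g₂, hker] at this
    exact Nat.eq_of_mul_eq_mul_right Nat.card_pos this
  have : φ g₁ ∈ (E g₂).range := addSubgroup_eq_of_card_eq hrange ▸ ⟨φ, rfl⟩
  exact this

lemma exists_hom_apply_eq
    (h : Nonempty ((G ⧸ AddSubgroup.zmultiples g₁) ≃+ (G ⧸ AddSubgroup.zmultiples g₂)))
    {H : Type*} [AddCommGroup H] [Finite H] (φ : G →+ H) : ∃ ψ : G →+ H, ψ g₂ = φ g₁ := by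
  classical
  obtain ⟨ι, _, n, hn, ⟨e⟩⟩ := AddCommGroup.equiv_directSum_zmod_of_finite' H
  let e' := e.trans (DirectSum.addEquivProd fun i => ZMod (n i))
  have (i : ι) : NeZero (n i) := ⟨by have := hn i; lia⟩
  choose ψ hψ using fun i : ι => exists_hom_zmod_apply_eq h (n i)
    ((Pi.evalAddMonoidHom _ i).comp (e'.toAddMonoidHom.comp φ))
  refine ⟨e'.symm.toAddMonoidHom.comp (AddMonoidHom.mk' (fun x i => ψ i x) ?_), ?_⟩
  · intro a b
    ext i
    simp
  · apply e'.injective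
    ext i
    simpa using hψ i

/-- If `g₁` and `g₂` have isomorphic quotients, then evaluation at `g₁` and evaluation at `g₂`
have fibres of equal size on the homomorphisms to any finite abelian group. -/
lemma exists_equiv_hom_apply_eq
    (h : Nonempty ((G ⧸ AddSubgroup.zmultiples g₁) ≃+ (G ⧸ AddSubgroup.zmultiples g₂)))
    (H : Type*) [AddCommGroup H] [Finite H] :
    ∃ σ : (G →+ H) ≃ (G →+ H), ∀ φ, σ φ g₂ = φ g₁ := by
  have := AddMonoidHom.finite_of_fg G H
  have shift (g : G) (φ₀ : G →+ H) :
      Nat.card {φ : G →+ H // φ g = φ₀ g} = Nat.card {φ : G →+ H // φ g = 0} :=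
    Nat.card_congr ((Equiv.subRight φ₀).subtypeEquiv fun φ => by simp [sub_eq_zero])
  have fibre (x : H) : Nonempty ({φ : G →+ H // φ g₁ = x} ≃ {φ : G →+ H // φ g₂ = x}) := by
    apply Finite.card_eq.1
    by_cases hx : ∃ φ : G →+ H, φ g₁ = x
    · obtain ⟨φ, rfl⟩ := hx
      obtain ⟨ψ, hψ⟩ := exists_hom_apply_eq h φ
      rw [shift g₁ φ, ← hψ, shift g₂ ψ, card_hom_killing_eq h]
    · have hx' : ¬ ∃ φ : G →+ H, φ g₂ = x := by
        rintro ⟨φ, rfl⟩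
        exact hx (exists_hom_apply_eq (h.map AddEquiv.symm) φ)
      have : IsEmpty {φ : G →+ H // φ g₁ = x} := ⟨fun φ => hx ⟨φ.1, φ.2⟩⟩
      have : IsEmpty {φ : G →+ H // φ g₂ = x} := ⟨fun φ => hx' ⟨φ.1, φ.2⟩⟩
      simp
  exact ⟨Equiv.ofFiberEquiv (f := fun φ : G →+ H => φ g₁) (g := fun φ : G →+ H => φ g₂)
    fun x => (fibre x).some, fun φ =>
      Equiv.ofFiberEquiv_map (f := fun φ : G →+ H => φ g₁) (g := fun φ : G →+ H => φ g₂) _ φ⟩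

end IsomorphicQuotients

section FreeModule

variable {F : Type*} [AddCommGroup F] [Module.Free ℤ F] [Module.Finite ℤ F]

lemma exists_generator_dual_apply (v : F) :
    ∃ (d : ℤ) (f : F →+ ℤ) (w : F), f v = d ∧ v = d • w := by
  let E : Module.Dual ℤ F →ₗ[ℤ] ℤ := Module.Dual.eval ℤ F v
  obtain ⟨d, hd⟩ := (IsPrincipalIdealRing.principal (LinearMap.range E : Ideal ℤ)).principal
  have hdvd (f : Module.Dual ℤ F) : d ∣ f v :=
    Ideal.mem_span_singleton.1 (hd.le ⟨f, rfl⟩)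
  obtain ⟨f, hf⟩ : d ∈ LinearMap.range E := hd.ge (Submodule.mem_span_singleton_self d)
  let b := Module.Free.chooseBasis ℤ F
  choose c hc using fun i => hdvd (b.coord i)
  refine ⟨d, f.toAddMonoidHom, ∑ i, c i • b i, hf, ?_⟩
  rw [Finset.smul_sum]
  conv_lhs => rw [← b.sum_repr v]
  refine Finset.sum_congr rfl fun i _ => ?_
  rw [smul_smul, ← hc i]
  rfl

lemma exists_addEquiv_of_apply_eq_one {w₁ w₂ : F} {f₁ f₂ : F →+ ℤ} (h₁ : f₁ w₁ = 1)
    (h₂ : f₂ w₂ = 1) : ∃ α : F ≃+ F, α w₁ = w₂ := by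
  let l₁ : F →ₗ[ℤ] ℤ := f₁.toIntLinearMap
  let l₂ : F →ₗ[ℤ] ℤ := f₂.toIntLinearMap
  have hl₁ : l₁ w₁ = 1 := h₁
  have hl₂ : l₂ w₂ = 1 := h₂
  have rank (l : F →ₗ[ℤ] ℤ) (w : F) (hl : l w = 1) :
      1 + Module.finrank ℤ (LinearMap.ker l) = Module.finrank ℤ F := by
    have hr : Function.Surjective l := fun x => ⟨x • w, by simp [hl]⟩
    rw [← (LinearMap.ker l).finrank_quotient_add_finrank,
      (l.quotKerEquivOfSurjective hr).finrank_eq, Module.finrank_self]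
  let e : LinearMap.ker l₁ ≃ₗ[ℤ] LinearMap.ker l₂ := LinearEquiv.ofFinrankEq _ _ (by
    have := rank l₁ w₁ hl₁
    have := rank l₂ w₂ hl₂
    lia)
  let p : F →ₗ[ℤ] LinearMap.ker l₁ :=
    (LinearMap.id - l₁.smulRight w₁).codRestrict _ fun x => by simp [hl₁]
  have hp_apply (x : F) : (p x : F) = x - l₁ x • w₁ := rfl
  let α : F →ₗ[ℤ] F := l₁.smulRight w₂ + (LinearMap.ker l₂).subtype ∘ₗ e.toLinearMap ∘ₗ p
  have hα : Function.Surjective α := by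
    intro y
    let z : LinearMap.ker l₂ := ⟨y - l₂ y • w₂, by simp [hl₂]⟩
    have hz : l₁ (e.symm z : F) = 0 := (e.symm z).2
    have hp : p (l₂ y • w₁ + e.symm z) = e.symm z := by
      ext
      rw [hp_apply]
      simp [hl₁, hz]
    refine ⟨l₂ y • w₁ + e.symm z, ?_⟩
    simp only [α, LinearMap.add_apply, LinearMap.comp_apply, hp]
    simp [hl₁, hz, z]
  have hp : p w₁ = 0 := by
    ext
    simp [hp_apply, hl₁]
  refine ⟨(LinearEquiv.ofBijective α
    (IsNoetherian.bijective_of_surjective_endomorphism α hα)).toAddEquiv, ?_⟩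
  change α w₁ = w₂
  simp [α, hp, hl₁]

/-- Two vectors of a free module of finite rank over `ℤ` with the same values under linear forms
are related by an automorphism. -/
lemma exists_addEquiv_of_dual_apply {v₁ v₂ : F}
    (h₁₂ : ∀ f : F →+ ℤ, ∃ f' : F →+ ℤ, f' v₂ = f v₁)
    (h₂₁ : ∀ f : F →+ ℤ, ∃ f' : F →+ ℤ, f' v₁ = f v₂) : ∃ α : F ≃+ F, α v₁ = v₂ := by
  obtain ⟨d, f₁, w₁, hf₁, hw₁⟩ := exists_generator_dual_apply v₁
  obtain ⟨d₂, f, w, hf, hw⟩ := exists_generator_dual_apply v₂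
  obtain ⟨f₂, hf₂⟩ := h₁₂ f₁
  obtain ⟨f', hf'⟩ := h₂₁ f
  obtain ⟨w₂, hw₂⟩ : ∃ w₂, v₂ = d • w₂ :=
    ⟨f' w₁ • w, by rw [smul_smul, ← smul_eq_mul d, ← map_zsmul, ← hw₁, hf', hf, ← hw]⟩
  rw [hf₁] at hf₂
  rcases eq_or_ne d 0 with rfl | hd
  · exact ⟨AddEquiv.refl F, by simp [hw₁, hw₂]⟩
  have one {f : F →+ ℤ} {v w : F} (hf : f v = d) (hv : v = d • w) : f w = 1 := by
    rw [hv, map_zsmul, smul_eq_mul] at hf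
    exact mul_left_cancel₀ hd (hf.trans (mul_one d).symm)
  obtain ⟨α, hα⟩ := exists_addEquiv_of_apply_eq_one (one hf₁ hw₁) (one hf₂ hw₂)
  exact ⟨α, by rw [hw₁, hw₂, map_zsmul, hα]⟩

end FreeModule

section Prod

variable {F T : Type*} [AddCommGroup F] [AddCommGroup T] [Finite T]

lemma exists_dual_apply_eq_of_quotient_equiv [Module.Free ℤ F] [Module.Finite ℤ F]
    {v₁ v₂ : F} {t₁ t₂ : T}
    (h : Nonempty (((F × T) ⧸ AddSubgroup.zmultiples (v₁, t₁)) ≃+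
      ((F × T) ⧸ AddSubgroup.zmultiples (v₂, t₂)))) (f : F →+ ℤ) :
    ∃ f' : F →+ ℤ, f' v₂ = f v₁ := by
  have : AddGroup.FG (F × T) :=
    Module.Finite.iff_addGroup_fg.1 (inferInstance : Module.Finite ℤ (F × T))
  obtain ⟨d, f₂, w, hf₂, hw⟩ := exists_generator_dual_apply v₂
  suffices hd : d ∣ f v₁ by
    obtain ⟨c, hc⟩ := hd
    exact ⟨c • f₂, by simp [hf₂, hc, mul_comm]⟩
  have key (k : ℕ) (hk : k ≠ 0) : ∃ c : ℤ, (k : ℤ) ∣ f v₁ - d * c := by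
    have hT : Nat.card T ≠ 0 := Nat.card_pos.ne'
    have : NeZero (Nat.card T * k) := ⟨mul_ne_zero hT hk⟩
    obtain ⟨χ, hχ⟩ := exists_hom_apply_eq h
      ((Int.castAddHom (ZMod (Nat.card T * k))).comp (f.comp (AddMonoidHom.fst F T)))
    obtain ⟨c, hc⟩ := ZMod.intCast_surjective (χ (w, 0))
    refine ⟨c, ?_⟩
    have hsplit : (v₂, t₂) = d • (w, (0 : T)) + (0, t₂) := by simp [← hw]
    have htors : (Nat.card T) • χ (0, t₂) = 0 := by
      rw [← map_nsmul, Prod.smul_mk, smul_zero, card_nsmul_eq_zero', ← Prod.zero_eq_mk, map_zero]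
    have : ((Nat.card T * (f v₁ - d * c) : ℤ) : ZMod (Nat.card T * k)) = 0 := by
      rw [hsplit, map_add, map_zsmul, ← hc] at hχ
      have hχ' := congrArg (Nat.card T • ·) hχ
      simp only [smul_add, htors, add_zero] at hχ'
      simp only [AddMonoidHom.comp_apply, AddMonoidHom.coe_fst, Int.coe_castAddHom,
        nsmul_eq_mul, zsmul_eq_mul] at hχ'
      push_cast
      rw [mul_sub, hχ', sub_self]
    rw [ZMod.intCast_zmod_eq_zero_iff_dvd, Nat.cast_mul] at this
    exact Int.dvd_of_mul_dvd_mul_left (by exact_mod_cast hT) this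
  rcases eq_or_ne d 0 with rfl | hd
  · obtain ⟨c, hc⟩ := key ((f v₁).natAbs + 1) (by simp)
    rw [zero_mul, sub_zero] at hc
    rw [Int.eq_zero_of_dvd_of_natAbs_lt_natAbs hc (by lia)]
  · obtain ⟨c, hc⟩ := key d.natAbs (by simpa)
    rw [Int.natCast_natAbs, abs_dvd] at hc
    exact (dvd_sub_left (dvd_mul_right d c)).1 hc

/-- When the two elements have the same free component, the torsion components are related by an
automorphism of the torsion part, up to a homomorphic image of the free component. -/
lemma exists_surjective_hom_apply_add [AddGroup.FG (F × T)] {v : F} {t₁ t₂ : T}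
    (h : Nonempty (((F × T) ⧸ AddSubgroup.zmultiples (v, t₁)) ≃+
      ((F × T) ⧸ AddSubgroup.zmultiples (v, t₂)))) :
    ∃ (ψ : T →+ T) (f : F →+ T), Function.Surjective ψ ∧ ψ t₁ + f v = t₂ := by
  classical
  have hfinT : Finite (T →+ T) := .of_injective _ DFunLike.coe_injective
  have := Fintype.ofFinite (T →+ T)
  let X : Set T := {x | ∃ f : F →+ T, x + f v = t₂}
  have hX {x : T} (f : F →+ T) : f v + x ∈ X ↔ x ∈ X := by
    constructor
    · rintro ⟨f', hf'⟩
      exact ⟨f + f', by rw [← hf', AddMonoidHom.add_apply]; abel⟩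
    · rintro ⟨f', hf'⟩
      exact ⟨f' - f, by rw [← hf', AddMonoidHom.sub_apply]; abel⟩
  have below (K : AddSubgroup T) :
      Nat.card {φ : T →+ T // φ t₁ ∈ X ∧ φ.range ≤ K} =
        Nat.card {φ : T →+ T // φ t₂ ∈ X ∧ φ.range ≤ K} := by
    have := AddMonoidHom.finite_of_fg (F × T) K
    have : Finite (F →+ K) := .of_injective (fun f => f.comp (AddMonoidHom.fst F T))
      fun f f' hff => by
        ext x
        exact congrArg (fun χ : F × T →+ K => (χ (x, 0) : T)) hff
    obtain ⟨σ, hσ⟩ := exists_equiv_hom_apply_eq h K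
    have e₁ (t : T) : {φ : T →+ T // φ t ∈ X ∧ φ.range ≤ K} ≃ {φ : T →+ K // (φ t : T) ∈ X} :=
      { toFun φ := ⟨φ.1.codRestrict K fun x => φ.2.2 ⟨x, rfl⟩, φ.2.1⟩
        invFun φ := ⟨K.subtype.comp φ.1, φ.2, by
          rintro _ ⟨x, rfl⟩
          exact (φ.1 x).2⟩
        left_inv φ := rfl
        right_inv φ := rfl }
    have e₂ (t : T) : (F →+ K) × {φ : T →+ K // (φ t : T) ∈ X} ≃
        {χ : F × T →+ K // (χ (v, t) : T) ∈ X} :=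
      { toFun p := ⟨p.1.coprod p.2.1, by
          simpa using (hX (K.subtype.comp p.1)).2 p.2.2⟩
        invFun χ := ⟨χ.1.comp (AddMonoidHom.inl F T), χ.1.comp (AddMonoidHom.inr F T), by
          refine (hX (K.subtype.comp (χ.1.comp (AddMonoidHom.inl F T)))).1 ?_
          have hsplit : χ.1 (v, t) = χ.1 (v, 0) + χ.1 (0, t) := by simp [← map_add]
          exact (congrArg (fun x : K => (x : T) ∈ X) hsplit).mp χ.2⟩
        left_inv p := by
          ext <;> simp
        right_inv χ := by
          ext
          simp }
    have e₃ : {χ : F × T →+ K // (χ (v, t₁) : T) ∈ X} ≃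
        {χ : F × T →+ K // (χ (v, t₂) : T) ∈ X} :=
      σ.subtypeEquiv fun χ => by rw [hσ]
    rw [Nat.card_congr (e₁ t₁), Nat.card_congr (e₁ t₂)]
    have hcard := Nat.card_congr ((e₂ t₁).trans (e₃.trans (e₂ t₂).symm))
    rw [Nat.card_prod, Nat.card_prod] at hcard
    exact Nat.eq_of_mul_eq_mul_left Nat.card_pos hcard
  have hcard := card_filter_eq_of_card_filter_le
    (Finset.univ.filter fun φ : T →+ T => φ t₁ ∈ X)
    (Finset.univ.filter fun φ : T →+ T => φ t₂ ∈ X) AddMonoidHom.range (fun K => by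
      simpa [Finset.filter_filter, Nat.card_eq_fintype_card, Fintype.card_subtype]
        using below K) ⊤
  have hid : AddMonoidHom.id T ∈
      (Finset.univ.filter fun φ : T →+ T => φ t₂ ∈ X).filter (·.range = ⊤) := by
    simp only [Finset.mem_filter, Finset.mem_univ, true_and]
    exact ⟨⟨0, by simp⟩, AddMonoidHom.range_eq_top.2 Function.surjective_id⟩
  obtain ⟨ψ, hψ⟩ := Finset.card_pos.1 (hcard ▸ Finset.card_pos.2 ⟨_, hid⟩)
  simp only [Finset.mem_filter, Finset.mem_univ, true_and] at hψ
  obtain ⟨⟨f, hf⟩, hψ⟩ := hψ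
  exact ⟨ψ, f, AddMonoidHom.range_eq_top.1 hψ, hf⟩

lemma quotient_zmultiples_equiv {G G' : Type*} [AddCommGroup G] [AddCommGroup G'] (e : G ≃+ G')
    {g : G} {g' : G'} (h : e g = g') :
    Nonempty ((G ⧸ AddSubgroup.zmultiples g) ≃+ (G' ⧸ AddSubgroup.zmultiples g')) :=
  ⟨QuotientAddGroup.congr _ _ e (by
    rw [← h]
    exact AddMonoidHom.map_zmultiples e.toAddMonoidHom g)⟩

lemma exists_addEquiv_prod_of_quotient_equiv [Module.Free ℤ F] [Module.Finite ℤ F] (g₁ g₂ : F × T)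
    (h : Nonempty (((F × T) ⧸ AddSubgroup.zmultiples g₁) ≃+
      ((F × T) ⧸ AddSubgroup.zmultiples g₂))) :
    ∃ e : F × T ≃+ F × T, e g₁ = g₂ := by
  have : AddGroup.FG (F × T) :=
    Module.Finite.iff_addGroup_fg.1 (inferInstance : Module.Finite ℤ (F × T))
  obtain ⟨v₁, t₁⟩ := g₁
  obtain ⟨v₂, t₂⟩ := g₂
  obtain ⟨α, rfl⟩ := exists_addEquiv_of_dual_apply (exists_dual_apply_eq_of_quotient_equiv h)
    (exists_dual_apply_eq_of_quotient_equiv (h.map AddEquiv.symm))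
  let a : F × T ≃+ F × T := α.prodCongr (AddEquiv.refl T)
  have h' : Nonempty (((F × T) ⧸ AddSubgroup.zmultiples (α v₁, t₁)) ≃+
      ((F × T) ⧸ AddSubgroup.zmultiples (α v₁, t₂))) := by
    obtain ⟨q⟩ := h
    obtain ⟨q'⟩ := quotient_zmultiples_equiv a (g := (v₁, t₁)) rfl
    exact ⟨q'.symm.trans q⟩
  obtain ⟨ψ, f, hψ, hf⟩ := exists_surjective_hom_apply_add h'
  let Ψ : T ≃+ T := AddEquiv.ofBijective ψ (Finite.surjective_iff_bijective.1 hψ)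
  let b : F × T ≃+ F × T :=
    { toFun p := (p.1, Ψ p.2 + f p.1)
      invFun p := (p.1, Ψ.symm (p.2 - f p.1))
      left_inv p := by simp
      right_inv p := by simp
      map_add' p q := by
        ext
        · simp
        · simp only [Prod.snd_add, Prod.fst_add, map_add]
          abel }
  exact ⟨a.trans b, Prod.ext rfl hf⟩

end Prod

/-- Let `G` be a finitely generated abelian group and `g₁, g₂ ∈ G` elements such that
the quotients `G ⧸ ⟨g₁⟩` and `G ⧸ ⟨g₂⟩` are isomorphic.  Then there is an automorphism
of `G` sending `g₁` to `g₂`. -/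
theorem stmt0 {G : Type*} [AddCommGroup G] [AddGroup.FG G] (g₁ g₂ : G)
    (h : Nonempty ((G ⧸ AddSubgroup.zmultiples g₁) ≃+ (G ⧸ AddSubgroup.zmultiples g₂))) :
    ∃ e : G ≃+ G, e g₁ = g₂ := by
  obtain ⟨n, ι, _, p, hp, k, ⟨e⟩⟩ := AddCommGroup.equiv_free_prod_directSum_zmod G
  have (i : ι) : NeZero (p i ^ k i) := ⟨pow_ne_zero _ (hp i).ne_zero⟩
  classical
  have : Finite (DirectSum ι fun i => ZMod (p i ^ k i)) :=
    .of_equiv _ (DirectSum.addEquivProd fun i => ZMod (p i ^ k i)).symm.toEquiv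
  obtain ⟨q⟩ := h
  obtain ⟨q₁⟩ := quotient_zmultiples_equiv e (g := g₁) rfl
  obtain ⟨q₂⟩ := quotient_zmultiples_equiv e (g := g₂) rfl
  obtain ⟨a, ha⟩ := exists_addEquiv_prod_of_quotient_equiv (e g₁) (e g₂)
    ⟨q₁.symm.trans (q.trans q₂)⟩
  exact ⟨e.trans (a.trans e.symm), by simp [ha]⟩
end

section
/- Let G be a finite abelian p-group and g₁, g₂ ∈ G elements such that G/⟨g₁⟩ ≅ G/⟨g₂⟩. Then there exists an automorphism of G that sends g₁ to g₂. -/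
/-- Double annihilator property of principal ideals of `ZMod n`. -/
theorem ZMod.dvd_of_forall_mul_eq_zero {n : ℕ} [NeZero n] {d y : ZMod n}
    (h : ∀ c : ZMod n, c * d = 0 → c * y = 0) : d ∣ y := by
  have hn : 0 < n := NeZero.pos n
  obtain ⟨k, hk⟩ := Nat.gcd_dvd_right d.val n
  obtain ⟨l, hl⟩ := Nat.gcd_dvd_left d.val n
  set g := Nat.gcd d.val n with hg
  have hk0 : 0 < k := Nat.pos_of_ne_zero (by rintro rfl; omega)
  have hkd : (k : ZMod n) * d = 0 := by
    rw [← ZMod.natCast_zmod_val d, hl, ← Nat.cast_mul, ZMod.natCast_eq_zero_iff]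
    exact ⟨l, by rw [hk]; ring⟩
  have hky := h _ hkd
  rw [← ZMod.natCast_zmod_val y, ← Nat.cast_mul, ZMod.natCast_eq_zero_iff] at hky
  obtain ⟨z, hz⟩ : g ∣ y.val := Nat.dvd_of_mul_dvd_mul_left hk0 <| by
    rwa [mul_comm k g, ← hk]
  have hbez : (g : ZMod n) = d * (Nat.gcdA d.val n : ZMod n) := by
    have := congrArg (Int.cast : ℤ → ZMod n) (Nat.gcd_eq_gcd_ab d.val n)
    push_cast at this
    simpa [← hg] using this
  rw [← ZMod.natCast_zmod_val y, hz, Nat.cast_mul, hbez]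
  exact ⟨_, mul_assoc _ _ _⟩

theorem ZMod.baer_self (n : ℕ) [NeZero n] : Module.Baer (ZMod n) (ZMod n) := by
  intro I f
  have : IsPrincipalIdealRing (ZMod n) :=
    IsPrincipalIdealRing.of_surjective (Int.castRingHom (ZMod n)) ZMod.intCast_surjective
  obtain ⟨d, rfl⟩ := IsPrincipalIdealRing.principal I
  have hd : d ∈ Submodule.span (ZMod n) {d} := Submodule.mem_span_singleton_self d
  obtain ⟨z, hz⟩ : d ∣ f ⟨d, hd⟩ := by
    refine ZMod.dvd_of_forall_mul_eq_zero fun c hc ↦ ?_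
    rw [← smul_eq_mul, ← map_smul]
    convert map_zero f
    exact Subtype.ext hc
  refine ⟨LinearMap.toSpanSingleton _ _ z, fun x hx ↦ ?_⟩
  obtain ⟨c, rfl⟩ := Submodule.mem_span_singleton.mp hx
  have : (⟨c • d, hx⟩ : Submodule.span (ZMod n) {d}) = c • ⟨d, hd⟩ := rfl
  rw [this, map_smul, map_smul, hz, LinearMap.toSpanSingleton_apply, smul_eq_mul d z]

section

variable {G : Type*} [AddCommGroup G]

theorem exists_addMonoidHom_zmod_apply_eq {n : ℕ} [NeZero n] {g : G} {y : ZMod n}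
    (h : ∀ k : ℕ, k • g ∈ (nsmulAddMonoidHom (α := G) n).range → k • y = 0) :
    ∃ f : G →+ ZMod n, f g = y := by
  let Q := G ⧸ (nsmulAddMonoidHom (α := G) n).range
  let mk : G →+ Q := QuotientAddGroup.mk' _
  have hQ : ∀ x : Q, n • x = 0 := fun x ↦ by
    obtain ⟨x, rfl⟩ := QuotientAddGroup.mk'_surjective _ x
    rw [← map_nsmul]
    exact (QuotientAddGroup.eq_zero_iff _).mpr ⟨x, rfl⟩
  let : Module (ZMod n) Q := AddCommGroup.zmodModule hQ
  let s := LinearMap.toSpanSingleton (ZMod n) Q (mk g)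
  let t := LinearMap.toSpanSingleton (ZMod n) (ZMod n) y
  have hst : s.ker ≤ t.ker := fun c hc ↦ by
    rw [LinearMap.mem_ker, LinearMap.toSpanSingleton_apply, ← ZMod.natCast_zmod_val c,
      Nat.cast_smul_eq_nsmul] at hc ⊢
    exact h _ ((QuotientAddGroup.eq_zero_iff _).mp (by rw [← hc, ← map_nsmul]; rfl))
  obtain ⟨f, hf⟩ := (ZMod.baer_self n).extension_property (s.ker.liftQ s le_rfl)
    (LinearMap.ker_eq_bot.mp (Submodule.ker_liftQ_eq_bot _ _ _ le_rfl)) (s.ker.liftQ t hst)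
  refine ⟨f.toAddMonoidHom.comp mk, ?_⟩
  have := LinearMap.congr_fun hf (Submodule.Quotient.mk 1)
  rw [LinearMap.comp_apply, Submodule.liftQ_apply, Submodule.liftQ_apply] at this
  simp only [s, t, LinearMap.toSpanSingleton_apply, one_smul] at this
  exact this

/-- A finite abelian group is fully transitive with respect to divisibility of multiples. -/
theorem exists_addMonoidHom_end_apply_eq [Finite G] {g₁ g₂ : G}
    (h : ∀ n k : ℕ, k • g₁ ∈ (nsmulAddMonoidHom (α := G) n).range →
      k • g₂ ∈ (nsmulAddMonoidHom (α := G) n).range) :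
    ∃ f : G →+ G, f g₁ = g₂ := by
  obtain ⟨ι, _, p, hp, m, ⟨e⟩⟩ := AddCommGroup.equiv_directSum_zmod_of_finite G
  let e' := e.trans (DirectSum.addEquivProd _)
  have key (i : ι) : ∃ f : G →+ ZMod (p i ^ m i), f g₁ = e' g₂ i := by
    have : NeZero (p i ^ m i) := ⟨pow_ne_zero _ (hp i).ne_zero⟩
    refine exists_addMonoidHom_zmod_apply_eq fun k hk ↦ ?_
    obtain ⟨x, hx⟩ := h _ _ hk
    rw [← Pi.smul_apply, ← map_nsmul, ← hx]
    simp
  choose f hf using key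
  exact ⟨e'.symm.toAddMonoidHom.comp (AddMonoidHom.pi f),
    e'.symm_apply_eq.mpr (funext fun i ↦ hf i)⟩

theorem addOrderOf_mk_mul_index [Finite G] (H : AddSubgroup G) (g : G) :
    addOrderOf (g : G ⧸ H) * (H ⊔ AddSubgroup.zmultiples g).index = H.index := by
  have h := AddSubgroup.index_map (AddSubgroup.zmultiples g) (QuotientAddGroup.mk' H)
  rw [AddMonoidHom.map_zmultiples, QuotientAddGroup.ker_mk', QuotientAddGroup.range_mk',
    AddSubgroup.index_top, mul_one, sup_comm] at h
  rw [← h, ← Nat.card_zmultiples, AddSubgroup.index, AddSubgroup.index]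
  exact AddSubgroup.card_mul_index _

theorem index_range_nsmul_quotient (H : AddSubgroup G) (n : ℕ) :
    (nsmulAddMonoidHom (α := G ⧸ H) n).range.index =
      ((nsmulAddMonoidHom (α := G) n).range ⊔ H).index := by
  have : (nsmulAddMonoidHom (α := G ⧸ H) n).range =
      (nsmulAddMonoidHom (α := G) n).range.map (QuotientAddGroup.mk' H) := by
    ext x
    constructor
    · rintro ⟨y, rfl⟩
      obtain ⟨y, rfl⟩ := QuotientAddGroup.mk'_surjective _ y
      exact ⟨n • y, ⟨y, rfl⟩, by simp⟩
    · rintro ⟨_, ⟨y, rfl⟩, rfl⟩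
      exact ⟨y, by simp⟩
  rw [this, AddSubgroup.index_map, QuotientAddGroup.ker_mk', QuotientAddGroup.range_mk',
    AddSubgroup.index_top, mul_one]

theorem index_range_nsmul_congr {H : Type*} [AddCommGroup H] (e : G ≃+ H) (n : ℕ) :
    (nsmulAddMonoidHom (α := G) n).range.index = (nsmulAddMonoidHom (α := H) n).range.index := by
  rw [← AddSubgroup.index_map_equiv _ e]
  congr 1
  ext x
  constructor
  · rintro ⟨_, ⟨y, rfl⟩, rfl⟩
    exact ⟨e y, by simp⟩
  · rintro ⟨y, rfl⟩
    exact ⟨n • e.symm y, ⟨e.symm y, rfl⟩, by simp⟩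

theorem nsmul_mem_range_nsmul_of_quotient_equiv [Finite G] {g₁ g₂ : G}
    (e : (G ⧸ AddSubgroup.zmultiples g₁) ≃+ (G ⧸ AddSubgroup.zmultiples g₂)) (n k : ℕ)
    (h : k • g₁ ∈ (nsmulAddMonoidHom (α := G) n).range) :
    k • g₂ ∈ (nsmulAddMonoidHom (α := G) n).range := by
  set N := (nsmulAddMonoidHom (α := G) n).range
  have hidx : (N ⊔ AddSubgroup.zmultiples g₁).index = (N ⊔ AddSubgroup.zmultiples g₂).index := by
    rw [← index_range_nsmul_quotient, ← index_range_nsmul_quotient, index_range_nsmul_congr e]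
  have hord : addOrderOf (g₁ : G ⧸ N) = addOrderOf (g₂ : G ⧸ N) := by
    have h₁ := addOrderOf_mk_mul_index N g₁
    rw [hidx, ← addOrderOf_mk_mul_index N g₂] at h₁
    exact Nat.eq_of_mul_eq_mul_right (Nat.pos_of_ne_zero AddSubgroup.index_ne_zero_of_finite) h₁
  rw [← QuotientAddGroup.eq_zero_iff, QuotientAddGroup.mk_nsmul, ← addOrderOf_dvd_iff_nsmul_eq_zero]
    at h ⊢
  rwa [← hord]

theorem card_addMonoidHom_apply_eq_congr [Finite G] {g₁ g₂ : G} {f f' : G →+ G}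
    (hf : f g₁ = g₂) (hf' : f' g₂ = g₁) {X : Type*} [AddCommGroup X] [Finite X] (x : X) :
    Nat.card {φ : X →+ G // φ x = g₁} = Nat.card {φ : X →+ G // φ x = g₂} := by
  have hfin : Finite (X →+ G) := DFunLike.finite _
  -- Two solution sets are translates of the same subgroup as soon as both are nonempty.
  have key {a b : G} {u : G →+ G} (hu : u a = b) :
      Nat.card {φ : X →+ G // φ x = a} ≤ Nat.card {φ : X →+ G // φ x = b} := by
    rcases isEmpty_or_nonempty {φ : X →+ G // φ x = a} with h | ⟨⟨ψ, hψ⟩⟩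
    · simp
    · refine Nat.card_le_card_of_injective
        (fun φ ↦ ⟨φ.1 - ψ + u.comp ψ, by simp [φ.2, hψ, hu]⟩) fun φ φ' h ↦ ?_
      simpa [Subtype.ext_iff] using h
  exact (key hf).antisymm (key hf')

theorem card_addMonoidHom_eq_sum_ker {X : Type*} [AddCommGroup X] [Finite X] [Finite G]
    [Fintype (AddSubgroup X)] (x : X) (g : G) :
    Nat.card {φ : X →+ G // φ x = g} =
      ∑ K : AddSubgroup X, Nat.card {φ : X →+ G // φ x = g ∧ φ.ker = K} := by
  have hfin : Finite (X →+ G) := DFunLike.finite _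
  rw [← Nat.card_sigma]
  exact Nat.card_congr
    { toFun := fun φ ↦ ⟨φ.1.ker, φ.1, φ.2, rfl⟩
      invFun := fun s ↦ ⟨s.2.1, s.2.2.1⟩
      left_inv := fun _ ↦ rfl
      right_inv := by rintro ⟨_, φ, h, rfl⟩; rfl }

theorem card_addMonoidHom_ker_eq {X : Type*} [AddCommGroup X] (K : AddSubgroup X) (x : X) (g : G) :
    Nat.card {φ : X →+ G // φ x = g ∧ φ.ker = K} =
      Nat.card {φ : (X ⧸ K) →+ G // φ x = g ∧ φ.ker = ⊥} := by
  refine Nat.card_congr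
    { toFun := fun φ ↦ ⟨QuotientAddGroup.lift K φ.1 φ.2.2.ge, φ.2.1, ?_⟩
      invFun := fun φ ↦ ⟨φ.1.comp (QuotientAddGroup.mk' K), φ.2.1, ?_⟩
      left_inv := fun _ ↦ rfl
      right_inv := fun φ ↦ Subtype.ext (QuotientAddGroup.addMonoidHom_ext _ rfl) }
  · obtain ⟨φ, -, rfl⟩ := φ
    exact (AddMonoidHom.ker_eq_bot_iff _).mpr (QuotientAddGroup.kerLift_injective φ)
  · rw [← AddMonoidHom.comap_ker, φ.2.2]
    exact QuotientAddGroup.ker_mk' K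

/-- Lovász's counting principle: the numbers of pointed homomorphisms from all finite groups
determine the numbers of injective ones. -/
theorem card_injective_addMonoidHom_congr [Finite G] {g₁ g₂ : G} {f f' : G →+ G}
    (hf : f g₁ = g₂) (hf' : f' g₂ = g₁) (n : ℕ) :
    ∀ (X : Type*) [AddCommGroup X] [Finite X] (x : X), Nat.card X = n →
      Nat.card {φ : X →+ G // φ x = g₁ ∧ φ.ker = ⊥} =
        Nat.card {φ : X →+ G // φ x = g₂ ∧ φ.ker = ⊥} := by
  classical
  induction n using Nat.strong_induction_on with
  | _ n ih =>
    intro X _ _ x hX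
    cases nonempty_fintype (AddSubgroup X)
    have h := card_addMonoidHom_apply_eq_congr hf hf' x
    rw [card_addMonoidHom_eq_sum_ker, card_addMonoidHom_eq_sum_ker,
      ← Finset.add_sum_erase _ _ (Finset.mem_univ ⊥),
      ← Finset.add_sum_erase _ _ (Finset.mem_univ ⊥)] at h
    refine Nat.add_right_cancel (h.trans (congrArg _ (Finset.sum_congr rfl fun K hK ↦ ?_).symm))
    rw [card_addMonoidHom_ker_eq K x g₁, card_addMonoidHom_ker_eq K x g₂]
    refine ih (Nat.card (X ⧸ K)) ?_ (X ⧸ K) x rfl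
    have hK1 : 1 < Nat.card K :=
      K.one_lt_card_iff_ne_bot.mpr (Finset.ne_of_mem_erase hK)
    rw [← hX, AddSubgroup.card_eq_card_quotient_mul_card_addSubgroup K]
    exact lt_mul_of_one_lt_right Nat.card_pos hK1

theorem exists_addEquiv_apply_eq [Finite G] {g₁ g₂ : G} {f f' : G →+ G}
    (hf : f g₁ = g₂) (hf' : f' g₂ = g₁) : ∃ e : G ≃+ G, e g₁ = g₂ := by
  have hfin : Finite (G →+ G) := DFunLike.finite _
  have h := card_injective_addMonoidHom_congr hf hf' _ G g₁ rfl
  have : Nonempty {φ : G →+ G // φ g₁ = g₁ ∧ φ.ker = ⊥} :=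
    ⟨AddMonoidHom.id G, rfl, (AddMonoidHom.ker_eq_bot_iff _).mpr Function.injective_id⟩
  obtain ⟨⟨φ, hφ, hker⟩⟩ := (Nat.card_pos_iff.mp (h ▸ Nat.card_pos)).1
  exact ⟨AddEquiv.ofBijective φ
    (Finite.injective_iff_bijective.mp ((AddMonoidHom.ker_eq_bot_iff _).mp hker)), hφ⟩

end

/-- Let `G` be a finite abelian `p`-group and `g₁, g₂ ∈ G` elements such that
`G ⧸ ⟨g₁⟩ ≅ G ⧸ ⟨g₂⟩`.  Then there is an automorphism of `G` sending `g₁` to `g₂`. -/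
theorem stmt1 {p : ℕ} (hp : p.Prime) {G : Type*} [AddCommGroup G] [Finite G]
    (hpG : ∀ x : G, ∃ j : ℕ, p ^ j • x = 0) (g₁ g₂ : G)
    (h : Nonempty ((G ⧸ AddSubgroup.zmultiples g₁) ≃+ (G ⧸ AddSubgroup.zmultiples g₂))) :
    ∃ e : G ≃+ G, e g₁ = g₂ := by
  obtain ⟨e⟩ := h
  obtain ⟨f, hf⟩ := exists_addMonoidHom_end_apply_eq (nsmul_mem_range_nsmul_of_quotient_equiv e)
  obtain ⟨f', hf'⟩ :=
    exists_addMonoidHom_end_apply_eq (nsmul_mem_range_nsmul_of_quotient_equiv e.symm)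
  exact exists_addEquiv_apply_eq hf hf'
end

section
/- Let G be a finite abelian p-group and g ∈ G an element of order p^l with l ≥ 1. Then for some s ≥ 1 there exist an isomorphism G ≅ (ℤ/p^{n₁}ℤ ⊕ ⋯ ⊕ ℤ/p^{n_{t−s}}ℤ) ⊕ (ℤ/p^{k₁}ℤ ⊕ ⋯ ⊕ ℤ/p^{k_s}ℤ) sending g to (0, …, 0, p^{k₁−r₁}, …, p^{k_s−r_s}), where r_s = l, all r_i > 0, and for s ≥ 2 the sequences satisfy k_i < k_{i+1}, r_i < r_{i+1}, 0 ≤ k₁ − r₁, and k_i − r_i < k_{i+1} − r_{i+1}. -/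
theorem exists_addEquiv_pi_zmod_prime_pow {p : ℕ} (hp : p.Prime) {G : Type*} [AddCommGroup G]
    [Finite G] (hpG : ∀ x : G, ∃ j : ℕ, p ^ j • x = 0) :
    ∃ (ι : Type) (_ : Fintype ι) (e : ι → ℕ), Nonempty (G ≃+ ∀ i, ZMod (p ^ e i)) := by
  classical
  obtain ⟨ι, hι, n, -, ⟨φ⟩⟩ := AddCommGroup.equiv_directSum_zmod_of_finite' G
  let ψ : G ≃+ ∀ i, ZMod (n i) := φ.trans (DirectSum.addEquivProd fun i => ZMod (n i))
  have hn : ∀ i, ∃ a, n i = p ^ a := by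
    intro i
    obtain ⟨j, hj⟩ := hpG (ψ.symm (Pi.single i 1))
    have h := congrArg (fun x => ψ x i) hj
    simp only [map_nsmul, AddEquiv.apply_symm_apply, map_zero, Pi.smul_apply, Pi.single_eq_same,
      Pi.zero_apply, nsmul_eq_mul, mul_one] at h
    rw [ZMod.natCast_eq_zero_iff, Nat.dvd_prime_pow hp] at h
    obtain ⟨a, -, ha⟩ := h
    exact ⟨a, ha⟩
  choose e he using hn
  obtain rfl : n = fun i => p ^ e i := funext he
  exact ⟨ι, hι, e, ⟨ψ⟩⟩

theorem ZMod.exists_unit_mul_eq_prime_pow {p : ℕ} (hp : p.Prime) {e : ℕ} {a : ZMod (p ^ e)}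
    (ha : a ≠ 0) : ∃ (u : (ZMod (p ^ e))ˣ) (v : ℕ), v < e ∧
      u * a = ((p ^ v : ℕ) : ZMod (p ^ e)) := by
  have : NeZero (p ^ e) := ⟨(pow_pos hp.pos e).ne'⟩
  have hval : a.val ≠ 0 := by rwa [Ne, ZMod.val_eq_zero]
  obtain ⟨v, b, hb, hab⟩ := Nat.exists_eq_pow_mul_and_not_dvd hval p hp.ne_one
  have hcop : b.Coprime (p ^ e) := ((hp.coprime_iff_not_dvd.2 hb).pow_left e).symm
  have hau : a = ((p ^ v : ℕ) : ZMod (p ^ e)) * ZMod.unitOfCoprime b hcop := by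
    rw [ZMod.coe_unitOfCoprime, ← Nat.cast_mul, ← hab, ZMod.natCast_zmod_val]
  refine ⟨(ZMod.unitOfCoprime b hcop)⁻¹, v, ?_, ?_⟩
  · by_contra! hve
    apply ha
    rw [hau, (ZMod.natCast_eq_zero_iff _ _).2 (pow_dvd_pow p hve), zero_mul]
  · rw [hau, mul_comm, mul_assoc, Units.mul_inv, mul_one]

theorem ZMod.exists_addMonoidHom_prime_pow (p : ℕ) {e e' v v' : ℕ} (hv : v' ≤ v)
    (hr : e - v ≤ e' - v') (hv' : v' ≤ e') :
    ∃ f : ZMod (p ^ e') →+ ZMod (p ^ e),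
      f ((p ^ v' : ℕ) : ZMod (p ^ e')) = ((p ^ v : ℕ) : ZMod (p ^ e)) := by
  have h0 : (zmultiplesHom (ZMod (p ^ e)) ((p ^ (v - v') : ℕ) : ZMod (p ^ e)))
      ((p ^ e' : ℕ) : ℤ) = 0 := by
    rw [zmultiplesHom_apply, natCast_zsmul, nsmul_eq_mul, ← Nat.cast_mul, ← pow_add,
      ZMod.natCast_eq_zero_iff]
    exact pow_dvd_pow p (by omega)
  refine ⟨ZMod.lift (p ^ e') ⟨_, h0⟩, ?_⟩
  rw [← Int.cast_natCast (p ^ v'), ZMod.lift_coe]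
  simp only [zmultiplesHom_apply]
  rw [natCast_zsmul, nsmul_eq_mul, ← Nat.cast_mul, ← pow_add, Nat.add_sub_cancel' hv]

/-- The transvection of a product of groups subtracting `f (x j)` from the `i`-th coordinate. -/
def AddEquiv.piShear {ι : Type*} [DecidableEq ι] {M : ι → Type*} [∀ i, AddCommGroup (M i)]
    {i j : ι} (hij : i ≠ j) (f : M j →+ M i) : (∀ i, M i) ≃+ ∀ i, M i where
  toFun x := x - Pi.single i (f (x j))
  invFun x := x + Pi.single i (f (x j))
  left_inv x := by simp [hij.symm]
  right_inv x := by simp [hij.symm]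
  map_add' x y := by
    simp only [Pi.add_apply, map_add, Pi.single_add]
    abel

/-- Splitting off and reindexing the coordinates of a product of groups. -/
def AddEquiv.piSumReindex {α β ι : Type*} (ρ : α ⊕ β ≃ ι) (M : ι → Type*)
    [∀ i, AddCommGroup (M i)] :
    (∀ i, M i) ≃+ (∀ a, M (ρ (Sum.inl a))) × ∀ b, M (ρ (Sum.inr b)) where
  toEquiv := (Equiv.piCongrLeft' M ρ.symm).trans
    (Equiv.sumPiEquivProdPi fun c => M (ρ c))
  map_add' _ _ := rfl

/-- The element with coordinates `p ^ v i` for `i ∈ S` and `0` elsewhere. -/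
def primePowVector {ι : Type*} [DecidableEq ι] (p : ℕ) (e v : ι → ℕ) (S : Finset ι) :
    ∀ i, ZMod (p ^ e i) :=
  fun i => if i ∈ S then ((p ^ v i : ℕ) : ZMod (p ^ e i)) else 0

theorem exists_addEquiv_eq_primePowVector {p : ℕ} (hp : p.Prime) {ι : Type*} [Fintype ι]
    [DecidableEq ι] {e : ι → ℕ} (x : ∀ i, ZMod (p ^ e i)) :
    ∃ (φ : (∀ i, ZMod (p ^ e i)) ≃+ ∀ i, ZMod (p ^ e i)) (v : ι → ℕ) (S : Finset ι),
      (∀ i ∈ S, v i < e i) ∧ φ x = primePowVector p e v S := by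
  classical
  have h : ∀ i, ∃ (u : (ZMod (p ^ e i))ˣ) (v : ℕ), x i ≠ 0 →
      v < e i ∧ u * x i = ((p ^ v : ℕ) : ZMod (p ^ e i)) := by
    intro i
    by_cases hx : x i = 0
    · exact ⟨1, 0, fun h => (h hx).elim⟩
    · obtain ⟨u, v, huv⟩ := ZMod.exists_unit_mul_eq_prime_pow hp hx
      exact ⟨u, v, fun _ => huv⟩
  choose u v huv using h
  refine ⟨AddEquiv.piCongrRight fun i => DistribMulAction.toAddEquiv _ (u i), v,
    Finset.univ.filter fun i => x i ≠ 0, fun i hi => (huv i (by simpa using hi)).1, ?_⟩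
  funext i
  by_cases hx : x i = 0
  · simp [primePowVector, hx]
  · simpa [primePowVector, hx, Units.smul_def] using (huv i hx).2

/-- Among the diagonal forms of `g`, one of minimal support has no coordinate that another one
can eliminate. -/
theorem exists_addEquiv_eq_primePowVector_reduced {p : ℕ} (hp : p.Prime) {ι G : Type*}
    [Fintype ι] [DecidableEq ι] [AddCommGroup G] {e : ι → ℕ} (ψ : G ≃+ ∀ i, ZMod (p ^ e i))
    (g : G) :
    ∃ (φ : G ≃+ ∀ i, ZMod (p ^ e i)) (v : ι → ℕ) (S : Finset ι),
      (∀ i ∈ S, v i < e i) ∧ φ g = primePowVector p e v S ∧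
      ∀ i ∈ S, ∀ j ∈ S, i ≠ j → v j ≤ v i → e j - v j < e i - v i := by
  classical
  have hex : ∃ (m : ℕ) (φ : G ≃+ ∀ i, ZMod (p ^ e i)) (v : ι → ℕ) (S : Finset ι),
      (∀ i ∈ S, v i < e i) ∧ φ g = primePowVector p e v S ∧ S.card = m := by
    obtain ⟨φ, v, S, hS, h⟩ := exists_addEquiv_eq_primePowVector hp (ψ g)
    exact ⟨S.card, ψ.trans φ, v, S, hS, h, rfl⟩
  obtain ⟨φ, v, S, hS, hg, hcard⟩ := Nat.find_spec hex
  refine ⟨φ, v, S, hS, hg, fun i hi j hj hij hv => ?_⟩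
  by_contra! hr
  obtain ⟨f, hf⟩ := ZMod.exists_addMonoidHom_prime_pow p hv hr (hS j hj).le
  refine Nat.find_min hex (m := (S.erase i).card) ?_
    ⟨φ.trans (AddEquiv.piShear (M := fun i => ZMod (p ^ e i)) hij f), v, S.erase i,
      fun a ha => hS a (Finset.mem_of_mem_erase ha), ?_, rfl⟩
  · rw [← hcard]
    exact Finset.card_erase_lt_of_mem hi
  · have hgj : primePowVector p e v S j = ((p ^ v j : ℕ) : ZMod (p ^ e j)) := if_pos hj
    change φ g - Pi.single i (f (φ g j)) = _
    rw [hg, hgj, hf]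
    funext a
    by_cases ha : a = i
    · subst ha
      simp [primePowVector, hi]
    · simp [primePowVector, ha]

theorem Finset.exists_equiv_fin_strictMono {ι : Type*} (S : Finset ι) {v : ι → ℕ}
    (hv : Set.InjOn v S) : ∃ σ : Fin S.card ≃ S, StrictMono fun a => v (σ a) := by
  let w : Fin S.card → ℕ := fun a => v (S.equivFin.symm a)
  refine ⟨(Tuple.sort w).trans S.equivFin.symm, (Tuple.monotone_sort w).strictMono_of_injective ?_⟩
  intro a b hab
  exact ((Tuple.sort w).trans S.equivFin.symm).injective
    (Subtype.ext (hv (Subtype.prop _) (Subtype.prop _) hab))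

theorem Finset.exists_sum_equiv {ι : Type*} [Fintype ι] [DecidableEq ι] (S : Finset ι) {s : ℕ}
    (σ : Fin s ≃ S) :
    ∃ ρ : Fin (Fintype.card ι - S.card) ⊕ Fin s ≃ ι,
      (∀ a, ρ (Sum.inl a) ∉ S) ∧ ∀ b, ρ (Sum.inr b) = σ b := by
  have hc : Fintype.card {i // i ∉ S} = Fintype.card ι - S.card := by
    rw [Fintype.card_subtype_compl, Fintype.card_coe]
  let τ : Fin (Fintype.card ι - S.card) ≃ {i // i ∉ S} := (Fintype.equivFinOfCardEq hc).symm
  exact ⟨(Equiv.sumComm _ _).trans ((Equiv.sumCongr σ τ).trans (Equiv.sumCompl (· ∈ S))),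
    fun a => (τ a).2, fun b => rfl⟩

theorem exists_nat_extension {m : ℕ} (a : Fin m → ℕ) : ∃ n : ℕ → ℕ, a = fun i => n i.1 :=
  ⟨fun i => if h : i < m then a ⟨i, h⟩ else 0, by simp⟩

theorem eq_sub_of_addOrderOf_primePowVector {p l : ℕ} (hp : p.Prime) {ι : Type*} [DecidableEq ι]
    {e v : ι → ℕ} {S : Finset ι} (hl : addOrderOf (primePowVector p e v S) = p ^ l) {j : ι}
    (hj : j ∈ S) (hmax : ∀ i ∈ S, e i - v i ≤ e j - v j) : e j - v j = l := by
  apply le_antisymm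
  · have h := congrFun (addOrderOf_nsmul_eq_zero (primePowVector p e v S)) j
    rw [hl, Pi.smul_apply, primePowVector, if_pos hj, nsmul_eq_mul, ← Nat.cast_mul, ← pow_add,
      Pi.zero_apply, ZMod.natCast_eq_zero_iff, Nat.pow_dvd_pow_iff_le_right hp.one_lt] at h
    omega
  · rw [← Nat.pow_dvd_pow_iff_le_right hp.one_lt, ← hl]
    apply addOrderOf_dvd_of_nsmul_eq_zero
    funext i
    by_cases hi : i ∈ S
    · rw [Pi.smul_apply, primePowVector, if_pos hi, nsmul_eq_mul, ← Nat.cast_mul, ← pow_add,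
        Pi.zero_apply, ZMod.natCast_eq_zero_iff]
      exact pow_dvd_pow p (by have := hmax i hi; omega)
    · simp [primePowVector, hi]

theorem exists_addEquiv_fin_normal_form {p : ℕ} (hp : p.Prime) {G : Type*} [AddCommGroup G]
    [Finite G] (hpG : ∀ x : G, ∃ j : ℕ, p ^ j • x = 0) (g : G) (l : ℕ) (hl : 1 ≤ l)
    (hg : addOrderOf g = p ^ l) :
    ∃ (t s : ℕ) (hs : 1 ≤ s) (_ : s ≤ t) (n : Fin (t - s) → ℕ) (k v : Fin s → ℕ)
      (E : G ≃+ (∀ i, ZMod (p ^ n i)) × ∀ i, ZMod (p ^ k i)),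
      E g = (0, fun i => ((p ^ v i : ℕ) : ZMod (p ^ k i))) ∧ (∀ i, v i < k i) ∧
      StrictMono v ∧ StrictMono (fun i => k i - v i) ∧
      k ⟨s - 1, by omega⟩ - v ⟨s - 1, by omega⟩ = l := by
  classical
  obtain ⟨ι, _, e, ⟨ψ⟩⟩ := exists_addEquiv_pi_zmod_prime_pow hp hpG
  obtain ⟨φ, v, S, hS, hφ, hred⟩ := exists_addEquiv_eq_primePowVector_reduced hp ψ g
  have hord : addOrderOf (primePowVector p e v S) = p ^ l := by
    rw [← hφ, ← hg]
    exact addOrderOf_injective φ.toAddMonoidHom φ.injective g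
  have hne : S.Nonempty := by
    rw [Finset.nonempty_iff_ne_empty]
    rintro rfl
    have h0 : primePowVector p e v ∅ = 0 := by
      funext i
      simp [primePowVector]
    rw [h0, addOrderOf_zero] at hord
    exact (Nat.one_lt_pow (by omega) hp.one_lt).ne hord
  have hinj : Set.InjOn v S := by
    intro i hi j hj hij
    by_contra hne
    have h1 := hred i hi j hj hne hij.ge
    have h2 := hred j hj i hi (Ne.symm hne) hij.le
    omega
  obtain ⟨σ, hσ⟩ := S.exists_equiv_fin_strictMono hinj
  obtain ⟨ρ, hρl, hρr⟩ := S.exists_sum_equiv σ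
  have hpos : 1 ≤ S.card := hne.card_pos
  have hr : StrictMono fun a => e (σ a) - v (σ a) := fun a b hab =>
    hred _ (σ b).2 _ (σ a).2 (fun h => hab.ne' (σ.injective (Subtype.ext h))) (hσ hab).le
  have hlast : e (σ ⟨S.card - 1, by omega⟩) - v (σ ⟨S.card - 1, by omega⟩) = l := by
    refine eq_sub_of_addOrderOf_primePowVector hp hord (σ _).2 fun i hi => ?_
    obtain ⟨a, ha⟩ := σ.surjective ⟨i, hi⟩
    have := hr.monotone (show a ≤ ⟨S.card - 1, by omega⟩ from Nat.le_sub_one_of_lt a.2)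
    simpa only [ha] using this
  have hlt : ∀ b, v (ρ (Sum.inr b)) < e (ρ (Sum.inr b)) := fun b => by
    rw [hρr]
    exact hS _ (σ b).2
  simp only [← hρr] at hσ hr hlast
  have hE : (φ.trans (AddEquiv.piSumReindex ρ fun i => ZMod (p ^ e i))) g =
      (0, fun b => ((p ^ v (ρ (Sum.inr b)) : ℕ) : ZMod (p ^ e (ρ (Sum.inr b))))) := by
    change ((fun a => φ g (ρ (Sum.inl a))), fun b => φ g (ρ (Sum.inr b))) = _
    rw [hφ]
    refine Prod.ext (funext fun a => if_neg (hρl a)) (funext fun b => if_pos ?_)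
    rw [hρr]
    exact (σ b).2
  exact ⟨Fintype.card ι, S.card, hpos, S.card_le_univ, _, _, _, _, hE, hlt, hσ, hr, hlast⟩


/-- Normal form of an element of order `p^l` (`l ≥ 1`) in a finite abelian `p`-group `G`:
there are `t ≥ s ≥ 1`, exponents `n`, `k` and numbers `r` with an isomorphism
`G ≅ (⊕ᵢ ℤ/p^{nᵢ}) ⊕ (⊕ᵢ ℤ/p^{kᵢ})` sending `g` to `(0, (p^{kᵢ−rᵢ})ᵢ)`, where
`r_s = l`, all `rᵢ > 0`, `kᵢ` increasing, `rᵢ` increasing and `kᵢ − rᵢ` strictly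
increasing. -/
theorem stmt10 {p : ℕ} (hp : p.Prime) {G : Type*} [AddCommGroup G] [Finite G]
    (hpG : ∀ x : G, ∃ j : ℕ, p ^ j • x = 0) (g : G) (l : ℕ) (hl : 1 ≤ l)
    (hg : addOrderOf g = p ^ l) :
    ∃ (t s : ℕ) (_ : 1 ≤ s) (_ : s ≤ t) (n k r : ℕ → ℕ)
      (e : G ≃+ ((∀ i : Fin (t - s), ZMod (p ^ n i.1)) × (∀ i : Fin s, ZMod (p ^ k i.1)))),
      e g = (0, fun i : Fin s => ((p ^ (k i.1 - r i.1) : ℕ) : ZMod (p ^ k i.1))) ∧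
      r (s - 1) = l ∧ (∀ i < s, 0 < r i) ∧
      (∀ i, i + 1 < s → k i < k (i + 1)) ∧
      (∀ i, i + 1 < s → r i < r (i + 1)) ∧
      (∀ i, i + 1 < s → k i - r i < k (i + 1) - r (i + 1)) := by
  obtain ⟨t, s, hs, hst, n', k', v', E, hE, hlt, hv, hr, hlast⟩ :=
    exists_addEquiv_fin_normal_form hp hpG g l hl hg
  obtain ⟨n, rfl⟩ := exists_nat_extension n'
  obtain ⟨k, rfl⟩ := exists_nat_extension k'
  obtain ⟨v, rfl⟩ := exists_nat_extension v'
  have hlt' : ∀ i < s, v i < k i := fun i hi => hlt ⟨i, hi⟩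
  have hv' : ∀ i, i + 1 < s → v i < v (i + 1) := fun i hi =>
    hv (show (⟨i, by omega⟩ : Fin s) < ⟨i + 1, hi⟩ from Nat.lt_succ_self i)
  have hr' : ∀ i, i + 1 < s → k i - v i < k (i + 1) - v (i + 1) := fun i hi =>
    hr (show (⟨i, by omega⟩ : Fin s) < ⟨i + 1, hi⟩ from Nat.lt_succ_self i)
  refine ⟨t, s, hs, hst, n, k, fun i => k i - v i, E, ?_, hlast, fun i hi => ?_, fun i hi => ?_,
    hr', fun i hi => ?_⟩
  · simp only [Nat.sub_sub_self (hlt' _ (Fin.is_lt _)).le]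
    exact hE
  · exact Nat.sub_pos_of_lt (hlt' i hi)
  · have := hlt' i (by omega)
    have := hv' i hi
    have := hr' i hi
    omega
  · simpa only [Nat.sub_sub_self (hlt' i (by omega)).le, Nat.sub_sub_self (hlt' _ hi).le]
      using hv' i hi
end

section
/- Let G be a finite abelian p-group and g ∈ G. Then the pair (G/⟨g⟩, G) satisfies condition (**): either G/⟨g⟩ ≅ G (when g = 0), or the exponent multisets I(G/⟨g⟩)∖I(G) and I(G)∖I(G/⟨g⟩) strictly interleave with the maximum lying in I(G). -/
/-- Condition (**) for a pair of finite abelian `p`-groups `(A, B)`: either `A ≅ B`, or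
`A ≅ N ⊕ ⊕ᵢ ℤ/p^{kᵢ}` and `B ≅ N ⊕ ⊕ᵢ ℤ/p^{k̃ᵢ}` with strictly interleaving exponents
`k₁ < k̃₁ < k₂ < k̃₂ < ⋯ < k_s < k̃_s`, so the maximum lies on the `B` side. -/
def DoubleStarPair (p : ℕ) (G Gt : Type*) [AddCommGroup G] [AddCommGroup Gt] : Prop :=
  Nonempty (G ≃+ Gt) ∨
    ∃ (m : ℕ) (nn : ℕ → ℕ) (s : ℕ) (k kt : ℕ → ℕ), 1 ≤ s ∧
      Nonempty (G ≃+ ((∀ i : Fin m, ZMod (p ^ nn i.1)) × (∀ i : Fin s, ZMod (p ^ k i.1)))) ∧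
      Nonempty (Gt ≃+ ((∀ i : Fin m, ZMod (p ^ nn i.1)) × (∀ i : Fin s, ZMod (p ^ kt i.1)))) ∧
      (∀ i < s, k i < kt i) ∧ ∀ i, i + 1 < s → kt i < k (i + 1)

/-- `M` is the multiset of exponents of a cyclic decomposition of `G`, with zeros allowed. -/
def HasExponents (p : ℕ) (G : Type*) [AddCommGroup G] (M : Multiset ℕ) : Prop :=
  ∃ (ι : Type) (_ : Fintype ι) (e : ι → ℕ),
    (Finset.univ : Finset ι).val.map e = M ∧ Nonempty (G ≃+ ∀ i, ZMod (p ^ e i))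

theorem exists_equiv_comp_eq_of_map_univ_eq {ι κ α : Type*} [Fintype ι] [Fintype κ]
    {e : ι → α} {f : κ → α}
    (h : (Finset.univ : Finset ι).val.map e = (Finset.univ : Finset κ).val.map f) :
    ∃ σ : ι ≃ κ, ∀ i, e i = f (σ i) := by
  classical
  have hc (c : α) : Nonempty ({a // e a = c} ≃ {b // f b = c}) := by
    rw [← Fintype.card_eq, Fintype.card_subtype, Fintype.card_subtype]
    have := congrArg (Multiset.count c) h
    simp only [Multiset.count_map] at this
    simpa only [Finset.card_def, Finset.filter_val, eq_comm] using this
  exact ⟨Equiv.ofFiberEquiv fun c => (hc c).some,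
    fun i => (Equiv.ofFiberEquiv_map (fun c => (hc c).some) i).symm⟩

namespace HasExponents

variable {p : ℕ} {G : Type*} [AddCommGroup G] {M : Multiset ℕ}

theorem nonempty_addEquiv (h : HasExponents p G M) {κ : Type*} [Fintype κ] {f : κ → ℕ}
    (hf : (Finset.univ : Finset κ).val.map f = M) :
    Nonempty (G ≃+ ∀ k, ZMod (p ^ f k)) := by
  obtain ⟨ι, _, e, he, ⟨φ⟩⟩ := h
  obtain ⟨σ, hσ⟩ := exists_equiv_comp_eq_of_map_univ_eq (hf.trans he.symm)
  obtain rfl : f = fun k => e (σ k) := funext hσ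
  exact ⟨φ.trans (LinearEquiv.piCongrLeft ℤ (fun i => ZMod (p ^ e i)) σ).symm.toAddEquiv⟩

theorem add_replicate_zero (h : HasExponents p G M) (d : ℕ) :
    HasExponents p G (M + Multiset.replicate d 0) := by
  obtain ⟨ι, _, e, rfl, ⟨φ⟩⟩ := h
  refine ⟨ι ⊕ Fin d, inferInstance, Sum.elim e fun _ => 0, ?_, ?_⟩
  · rw [← Finset.univ_disjSum_univ, Finset.val_disjSum, Multiset.disjSum, Multiset.map_add]
    simp [← Multiset.coe_replicate]
  · have : Unique (∀ i : Fin d, ZMod (p ^ Sum.elim e (fun _ => 0) (Sum.inr i : ι ⊕ Fin d))) := by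
      simp only [Sum.elim_inr, pow_zero]; infer_instance
    exact ⟨φ.trans (AddEquiv.prodUnique.symm.trans
      (LinearEquiv.sumPiEquivProdPi ℤ ι (Fin d)
        (fun i => ZMod (p ^ Sum.elim e (fun _ => 0) i))).symm.toAddEquiv)⟩

end HasExponents

theorem card_range_nsmul_zmod {p : ℕ} (hp : p.Prime) (e j : ℕ) :
    Nat.card (nsmulAddMonoidHom (α := ZMod (p ^ e)) (p ^ j)).range =
      Nat.card (nsmulAddMonoidHom (α := ZMod (p ^ e)) (p ^ (j + 1))).range *
        p ^ (if j < e then 1 else 0) := by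
  have : NeZero (p ^ e) := ⟨pow_ne_zero _ hp.ne_zero⟩
  have key (j : ℕ) : Nat.card (nsmulAddMonoidHom (α := ZMod (p ^ e)) (p ^ j)).range =
      p ^ (e - j) := by
    rw [IsAddCyclic.card_nsmulAddMonoidHom_range, Nat.card_zmod]
    rcases le_total e j with h | h
    · rw [Nat.gcd_eq_left (pow_dvd_pow p h), Nat.div_self (pow_pos hp.pos _),
        Nat.sub_eq_zero_of_le h, pow_zero]
    · rw [Nat.gcd_eq_right (pow_dvd_pow p h), Nat.pow_div h hp.pos]
  rw [key, key, ← pow_add]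
  congr 1
  split_ifs <;> omega

theorem card_range_nsmul_pi {ι : Type*} [Fintype ι] (A : ι → Type*) [∀ i, AddCommGroup (A i)]
    (n : ℕ) : Nat.card (nsmulAddMonoidHom (α := ∀ i, A i) n).range =
      ∏ i, Nat.card (nsmulAddMonoidHom (α := A i) n).range := by
  have h : Set.range (fun x : ∀ i, A i => n • x) =
      Set.univ.pi fun i => Set.range fun x : A i => n • x :=
    Set.range_piMap fun i (x : A i) => n • x
  rw [← Nat.card_pi]
  exact Nat.card_congr ((Equiv.setCongr h).trans (Equiv.Set.univPi _))

theorem AddEquiv.card_range_nsmul {G H : Type*} [AddCommGroup G] [AddCommGroup H] (φ : G ≃+ H)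
    (n : ℕ) : Nat.card (nsmulAddMonoidHom (α := G) n).range =
      Nat.card (nsmulAddMonoidHom (α := H) n).range := by
  have : (nsmulAddMonoidHom (α := H) n).range =
      (nsmulAddMonoidHom (α := G) n).range.map (φ : G →+ H) := by
    ext x
    simp only [AddMonoidHom.mem_range, AddSubgroup.mem_map, nsmulAddMonoidHom_apply]
    constructor
    · rintro ⟨y, rfl⟩
      exact ⟨_, ⟨φ.symm y, rfl⟩, by simp⟩
    · rintro ⟨_, ⟨y, rfl⟩, rfl⟩
      exact ⟨φ y, by simp⟩
  rw [this]
  exact Nat.card_congr (φ.addSubgroupMap _).toEquiv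

theorem HasExponents.card_range_nsmul {p : ℕ} (hp : p.Prime) {G : Type*} [AddCommGroup G]
    {M : Multiset ℕ} (h : HasExponents p G M) (j : ℕ) :
    Nat.card (nsmulAddMonoidHom (α := G) (p ^ j)).range =
      Nat.card (nsmulAddMonoidHom (α := G) (p ^ (j + 1))).range *
        p ^ M.countP (j < ·) := by
  obtain ⟨ι, _, e, rfl, ⟨φ⟩⟩ := h
  rw [φ.card_range_nsmul, φ.card_range_nsmul, card_range_nsmul_pi, card_range_nsmul_pi,
    Finset.prod_congr rfl fun i _ => card_range_nsmul_zmod hp (e i) j,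
    Finset.prod_mul_distrib, Finset.prod_pow_eq_pow_sum, Multiset.countP_map,
    ← Finset.filter_val, ← Finset.card_def, Finset.card_filter]

theorem AddSubgroup.card_map_mul_card_inf_ker {G H : Type*} [AddGroup G] [AddGroup H]
    (f : G →+ H) (K : AddSubgroup G) :
    Nat.card (K.map f) * Nat.card (K ⊓ f.ker : AddSubgroup G) = Nat.card K := by
  rw [← AddSubgroup.card_mul_index (f.domRestrict K).ker, AddSubgroup.index_ker,
    AddMonoidHom.domRestrict_range, AddMonoidHom.ker_domRestrict, mul_comm]
  congr 1
  rw [← AddSubgroup.inf_addSubgroupOf_left]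
  exact Nat.card_congr (AddSubgroup.addSubgroupOfEquivOfLe inf_le_left).symm.toEquiv

theorem card_inf_ker_nsmul_le {G : Type*} [AddCommGroup G] [Finite G] (g : G) {n : ℕ}
    (hn : 0 < n) :
    Nat.card (AddSubgroup.zmultiples g ⊓ (nsmulAddMonoidHom (α := G) n).ker : AddSubgroup G) ≤
      n := by
  classical
  have := Fintype.ofFinite (AddSubgroup.zmultiples g)
  refine le_trans ?_ (IsAddCyclic.card_nsmul_eq_zero_le (α := AddSubgroup.zmultiples g) hn)
  rw [← Fintype.card_coe, ← Nat.card_eq_fintype_card]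
  refine Nat.card_le_card_of_injective (fun x => ⟨⟨x.1, x.2.1⟩, ?_⟩) fun x y hxy => ?_
  · rw [Finset.mem_filter]
    exact ⟨Finset.mem_univ _, Subtype.ext x.2.2⟩
  · exact Subtype.ext (congrArg (fun z => (z.1 : G)) hxy)

theorem HasExponents.countP_quotient_zmultiples {p : ℕ} (hp : p.Prime) {G : Type*}
    [AddCommGroup G] [Finite G] {g : G} {I J : Multiset ℕ}
    (hI : HasExponents p (G ⧸ AddSubgroup.zmultiples g) I) (hJ : HasExponents p G J) (j : ℕ) :
    I.countP (j < ·) ≤ J.countP (j < ·) ∧ J.countP (j < ·) ≤ I.countP (j < ·) + 1 := by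
  set Z := AddSubgroup.zmultiples g
  let D (j : ℕ) : AddSubgroup G := (nsmulAddMonoidHom (p ^ j)).range
  let H (j : ℕ) : AddSubgroup G := D j ⊓ Z
  have hmap (j : ℕ) : (nsmulAddMonoidHom (α := G ⧸ Z) (p ^ j)).range =
      (D j).map (QuotientAddGroup.mk' Z) := by
    ext x
    constructor
    · rintro ⟨y, rfl⟩
      obtain ⟨y, rfl⟩ := QuotientAddGroup.mk'_surjective Z y
      exact ⟨_, ⟨y, rfl⟩, by simp⟩
    · rintro ⟨_, ⟨y, rfl⟩, rfl⟩
      exact ⟨QuotientAddGroup.mk' Z y, by simp⟩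
  have hcard (j : ℕ) : Nat.card (nsmulAddMonoidHom (α := G ⧸ Z) (p ^ j)).range *
      Nat.card (H j) = Nat.card (D j) := by
    rw [hmap, ← AddSubgroup.card_map_mul_card_inf_ker (QuotientAddGroup.mk' Z) (D j),
      QuotientAddGroup.ker_mk']
  have hD : D (j + 1) = (D j).map (nsmulAddMonoidHom p) := by
    ext x
    constructor
    · rintro ⟨y, rfl⟩
      exact ⟨_, ⟨y, rfl⟩, by simp [pow_succ', mul_smul]⟩
    · rintro ⟨_, ⟨y, rfl⟩, rfl⟩
      exact ⟨y, by simp [pow_succ', mul_smul]⟩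
  have hle : Nat.card (H (j + 1)) ≤ Nat.card (H j) := by
    refine AddSubgroup.card_le_of_le (inf_le_inf_right _ ?_)
    rintro _ ⟨y, rfl⟩
    exact ⟨p • y, by simp [pow_succ, mul_smul]⟩
  have hle' : Nat.card (H j) ≤ Nat.card (H (j + 1)) * p := by
    rw [← AddSubgroup.card_map_mul_card_inf_ker (nsmulAddMonoidHom p) (H j)]
    refine Nat.mul_le_mul (AddSubgroup.card_le_of_le ?_) (le_trans (AddSubgroup.card_le_of_le
      (inf_le_inf_right _ inf_le_right)) (card_inf_ker_nsmul_le g hp.pos))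
    refine le_inf (hD ▸ AddSubgroup.map_mono inf_le_left) ?_
    rintro _ ⟨y, hy, rfl⟩
    exact Z.nsmul_mem hy.2 p
  have key : Nat.card (H j) * p ^ I.countP (j < ·) =
      Nat.card (H (j + 1)) * p ^ J.countP (j < ·) := by
    have h1 := hI.card_range_nsmul hp j
    have h2 : Nat.card (D j) = Nat.card (D (j + 1)) * _ := hJ.card_range_nsmul hp j
    rw [← hcard, ← hcard, h1] at h2
    refine Nat.eq_of_mul_eq_mul_left
      (Nat.card_pos (α := (nsmulAddMonoidHom (α := G ⧸ Z) (p ^ (j + 1))).range)) ?_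
    linarith
  have hpos : 0 < Nat.card (H (j + 1)) := Nat.card_pos
  constructor <;> rw [← Nat.pow_le_pow_iff_right hp.one_lt]
  · refine Nat.le_of_mul_le_mul_left ?_ hpos
    rw [← key]
    exact Nat.mul_le_mul_right _ hle
  · refine Nat.le_of_mul_le_mul_left ?_ hpos
    rw [← key, pow_succ', ← mul_assoc]
    exact Nat.mul_le_mul_right _ hle'

theorem exists_hasExponents {p : ℕ} (hp : p.Prime) {G : Type*} [AddCommGroup G] [Finite G]
    (hpG : ∀ x : G, ∃ j : ℕ, p ^ j • x = 0) : ∃ M, HasExponents p G M := by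
  obtain ⟨ι, _, q, hq, e, ⟨φ⟩⟩ := AddCommGroup.equiv_directSum_zmod_of_finite G
  classical
  have h (i : ι) : q i ^ e i = p ^ e i := by
    by_cases hi : e i = 0
    · simp [hi]
    obtain ⟨j, hj⟩ := hpG (φ.symm (DirectSum.of (fun i => ZMod (q i ^ e i)) i 1))
    rw [← map_nsmul, ← map_nsmul, EmbeddingLike.map_eq_zero_iff,
      (DirectSum.of_injective i).eq_iff' (map_zero _), nsmul_one, ZMod.natCast_eq_zero_iff] at hj
    rw [(Nat.prime_dvd_prime_iff_eq (hq i) hp).1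
      ((hq i).dvd_of_dvd_pow ((dvd_pow_self _ hi).trans hj))]
  refine ⟨_, ι, inferInstance, e, rfl, ⟨φ.trans ((DirectSum.addEquivProd _).trans ?_)⟩⟩
  exact AddEquiv.piCongrRight fun i => (ZMod.ringEquivCongr (h i)).toAddEquiv

theorem Multiset.exists_monotoneOn_map_range_eq (M : Multiset ℕ) :
    ∃ k : ℕ → ℕ, (∀ i j, i ≤ j → j < M.card → k i ≤ k j) ∧
      (Multiset.range M.card).map k = M := by
  have hl : (M.sort).length = M.card := by simp
  refine ⟨fun i => (M.sort).getD i 0, fun i j hij hj => ?_, ?_⟩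
  · have hs : (M.sort).SortedLE := (M.pairwise_sort _).sortedLE
    rw [← hl] at hj
    dsimp only
    rw [List.getD_eq_getElem _ _ hj, List.getD_eq_getElem _ _ (hij.trans_lt hj)]
    exact hs.getElem_le_getElem_of_le hij
  · conv_rhs => rw [← M.sort_eq (· ≤ ·)]
    rw [← hl, ← Multiset.coe_range, Multiset.map_coe, Multiset.coe_eq_coe]
    refine List.Perm.of_eq (List.ext_getElem (by simp) fun i h1 h2 => ?_)
    rw [List.getElem_map, List.getElem_range, List.getD_eq_getElem _ _ h2]

theorem countP_map_range_le {s : ℕ} {k : ℕ → ℕ} (hk : ∀ i j, i ≤ j → j < s → k i ≤ k j)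
    {i a : ℕ} (hi : i < s) (ha : k i ≤ a) :
    ((Multiset.range s).map k).countP (a < ·) ≤ s - (i + 1) := by
  rw [Multiset.countP_map, ← Finset.range_val, ← Finset.filter_val, ← Finset.card_def,
    ← Nat.card_Ico]
  refine Finset.card_le_card fun j hj => ?_
  rw [Finset.mem_filter, Finset.mem_range] at hj
  rw [Finset.mem_Ico]
  refine ⟨?_, hj.1⟩
  by_contra! h
  have := hk j i (by omega) hi
  omega

theorem le_countP_map_range {s : ℕ} {k : ℕ → ℕ} (hk : ∀ i j, i ≤ j → j < s → k i ≤ k j)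
    {i a : ℕ} (ha : a < k i) :
    s - i ≤ ((Multiset.range s).map k).countP (a < ·) := by
  rw [Multiset.countP_map, ← Finset.range_val, ← Finset.filter_val, ← Finset.card_def,
    ← Nat.card_Ico]
  refine Finset.card_le_card fun j hj => ?_
  rw [Finset.mem_Ico] at hj
  rw [Finset.mem_filter, Finset.mem_range]
  exact ⟨hj.2, ha.trans_le (hk i j hj.1 hj.2)⟩

theorem Multiset.exists_interleaving {I J : Multiset ℕ} (hcard : I.card = J.card)
    (hdisj : Disjoint I J)
    (h : ∀ a, I.countP (a < ·) ≤ J.countP (a < ·) ∧ J.countP (a < ·) ≤ I.countP (a < ·) + 1) :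
    ∃ k kt : ℕ → ℕ, (Multiset.range I.card).map k = I ∧ (Multiset.range I.card).map kt = J ∧
      (∀ i < I.card, k i < kt i) ∧ ∀ i, i + 1 < I.card → kt i < k (i + 1) := by
  obtain ⟨k, hk, hkI⟩ := I.exists_monotoneOn_map_range_eq
  obtain ⟨kt, hkt, hkJ⟩ := J.exists_monotoneOn_map_range_eq
  rw [← hcard] at hkt hkJ
  generalize I.card = s at *
  subst hkI hkJ
  have hne (i j : ℕ) (hi : i < s) (hj : j < s) : k i ≠ kt j := fun e =>
    Multiset.disjoint_left.1 hdisj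
      (Multiset.mem_map_of_mem _ (Multiset.mem_range.2 hi))
      (e ▸ Multiset.mem_map_of_mem _ (Multiset.mem_range.2 hj))
  refine ⟨k, kt, rfl, rfl, fun i hi => ?_, fun i hi => ?_⟩
  · by_contra! hlt
    have h1 := le_countP_map_range hk (lt_of_le_of_ne hlt (hne i i hi hi).symm)
    have h2 := countP_map_range_le hkt hi le_rfl
    have := (h (kt i)).1
    omega
  · by_contra! hlt
    have h1 := le_countP_map_range hkt (lt_of_le_of_ne hlt (hne (i + 1) i hi (by omega)))
    have h2 := countP_map_range_le hk hi le_rfl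
    have := (h (k (i + 1))).2
    omega

theorem HasExponents.nonempty_addEquiv_prod {p : ℕ} {G : Type*} [AddCommGroup G] {m s : ℕ}
    {nn k : ℕ → ℕ}
    (h : HasExponents p G ((Multiset.range m).map nn + (Multiset.range s).map k)) :
    Nonempty (G ≃+ ((∀ i : Fin m, ZMod (p ^ nn i.1)) × (∀ i : Fin s, ZMod (p ^ k i.1)))) := by
  have hr (n : ℕ) (f : ℕ → ℕ) : (Finset.univ : Finset (Fin n)).val.map (fun i => f i.1) =
      (Multiset.range n).map f := by
    rw [← Finset.range_val, ← Nat.Iio_eq_range, ← Fin.map_valEmbedding_univ, Finset.map_val,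
      Multiset.map_map]
    rfl
  obtain ⟨φ⟩ := h.nonempty_addEquiv (κ := Fin m ⊕ Fin s)
    (f := Sum.elim (fun i => nn i.1) fun i => k i.1) (by
      rw [← Finset.univ_disjSum_univ, Finset.val_disjSum, Multiset.disjSum, Multiset.map_add,
        Multiset.map_map, Multiset.map_map, ← hr, ← hr]
      rfl)
  exact ⟨φ.trans (LinearEquiv.sumPiEquivProdPi ℤ (Fin m) (Fin s)
    (fun i => ZMod (p ^ Sum.elim (fun i => nn i.1) (fun i => k i.1) i))).toAddEquiv⟩

theorem doubleStarPair_of_countP {p : ℕ} {A B : Type*} [AddCommGroup A] [AddCommGroup B]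
    {I J : Multiset ℕ} (hI : HasExponents p A I) (hJ : HasExponents p B J)
    (hcard : I.card = J.card)
    (h : ∀ a, I.countP (a < ·) ≤ J.countP (a < ·) ∧ J.countP (a < ·) ≤ I.countP (a < ·) + 1) :
    DoubleStarPair p A B := by
  by_cases hIJ : I = J
  · subst hIJ
    obtain ⟨ι, _, e, he, ⟨φ⟩⟩ := hI
    obtain ⟨ψ⟩ := hJ.nonempty_addEquiv he
    exact Or.inl ⟨φ.trans ψ.symm⟩
  have hI' : I ∩ J + (I - J) = I := by
    ext a; simp only [Multiset.count_add, Multiset.count_inter, Multiset.count_sub]; omega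
  have hJ' : I ∩ J + (J - I) = J := by
    ext a; simp only [Multiset.count_add, Multiset.count_inter, Multiset.count_sub]; omega
  have hcard' : (I - J).card = (J - I).card := by
    have h1 := congrArg Multiset.card hI'
    have h2 := congrArg Multiset.card hJ'
    rw [Multiset.card_add] at h1 h2
    omega
  have hdisj : Disjoint (I - J) (J - I) := by
    rw [Multiset.disjoint_left]
    intro a h1 h2
    rw [Multiset.mem_sub] at h1 h2
    omega
  obtain ⟨k, kt, hk, hkt, h1, h2⟩ := Multiset.exists_interleaving hcard' hdisj fun a => by
    have ha := h a
    have h1 := congrArg (Multiset.countP (a < ·)) hI'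
    have h2 := congrArg (Multiset.countP (a < ·)) hJ'
    rw [Multiset.countP_add] at h1 h2
    omega
  obtain ⟨nn, -, hnn⟩ := (I ∩ J).exists_monotoneOn_map_range_eq
  refine Or.inr ⟨_, nn, (I - J).card, k, kt, ?_, HasExponents.nonempty_addEquiv_prod
    (by rwa [hnn, hk, hI']), HasExponents.nonempty_addEquiv_prod (by rwa [hnn, hkt, hJ']),
    h1, h2⟩
  rw [Nat.one_le_iff_ne_zero]
  intro h0
  have h0' := hcard'.symm.trans h0
  rw [Multiset.card_eq_zero] at h0 h0'
  rw [h0, add_zero] at hI'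
  rw [h0', add_zero] at hJ'
  have heq : I = J := hI'.symm.trans hJ'
  exact absurd heq hIJ

/-- For a finite abelian `p`-group `G` and `g ∈ G`, the pair `(G ⧸ ⟨g⟩, G)` satisfies
condition (**). -/
theorem stmt13 {p : ℕ} (hp : p.Prime) {G : Type*} [AddCommGroup G] [Finite G]
    (hpG : ∀ x : G, ∃ j : ℕ, p ^ j • x = 0) (g : G) :
    DoubleStarPair p (G ⧸ AddSubgroup.zmultiples g) G := by
  obtain ⟨J, hJ⟩ := exists_hasExponents hp hpG
  obtain ⟨I, hI⟩ := exists_hasExponents hp (G := G ⧸ AddSubgroup.zmultiples g) fun x => by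
    obtain ⟨x, rfl⟩ := QuotientAddGroup.mk'_surjective _ x
    obtain ⟨j, hj⟩ := hpG x
    exact ⟨j, by rw [← map_nsmul, hj, map_zero]⟩
  have hI' := hI.add_replicate_zero J.card
  have hJ' := hJ.add_replicate_zero I.card
  exact doubleStarPair_of_countP hI' hJ' (by simp [add_comm])
    (hI'.countP_quotient_zmultiples hp hJ')
end

section
/- Let G be a finite abelian p-group, g ∈ G, and l ≥ 1. Then the pair (G, (G ⊕ ℤ)/⟨(g, p^l)⟩) satisfies condition (**); in particular I(G) ∩ I((G ⊕ ℤ)/⟨(g, p^l)⟩) ≠ I(G), i.e., the quotient group is never isomorphic to G. -/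
/-- The subgroup of elements of `H` that are killed by `p` and divisible by `p ^ k`. Its order is
`p ^ r`, where `r` is the number of cyclic factors of `H` of order larger than `p ^ k`. -/
def ulmSubgroup (p k : ℕ) (H : Type*) [AddCommGroup H] : AddSubgroup H :=
  (nsmulAddMonoidHom (p ^ k) : H →+ H).range ⊓ (nsmulAddMonoidHom p : H →+ H).ker

lemma mem_ulmSubgroup {p k : ℕ} {H : Type*} [AddCommGroup H] {x : H} :
    x ∈ ulmSubgroup p k H ↔ (∃ y, p ^ k • y = x) ∧ p • x = 0 := by
  simp [ulmSubgroup, AddSubgroup.mem_inf, AddMonoidHom.mem_ker]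

lemma card_ulmSubgroup_le_of_injective {p k : ℕ} {G H : Type*} [AddCommGroup G] [AddCommGroup H]
    [Finite H] (f : G →+ H) (hf : Function.Injective f) :
    Nat.card (ulmSubgroup p k G) ≤ Nat.card (ulmSubgroup p k H) := by
  have h (x : ulmSubgroup p k G) : f x ∈ ulmSubgroup p k H := by
    obtain ⟨⟨y, hy⟩, hx⟩ := mem_ulmSubgroup.1 x.2
    exact mem_ulmSubgroup.2 ⟨⟨f y, by rw [← map_nsmul, hy]⟩, by rw [← map_nsmul, hx, map_zero]⟩
  refine Nat.card_le_card_of_injective (fun x ↦ (⟨f x, h x⟩ : ulmSubgroup p k H)) ?_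
  intro x y hxy
  exact Subtype.ext (hf (congrArg Subtype.val hxy))

lemma card_ulmSubgroup_le_mul_of_cyclic_quotient {p k : ℕ} (hp : 0 < p) {G H : Type*}
    [AddCommGroup G] [AddCommGroup H] [Finite H] (f : G →+ H) (hf : Function.Injective f)
    (e : H) (he : ∀ h : H, ∃ (x : G) (n : ℤ), h = f x + n • e) :
    Nat.card (ulmSubgroup p k H) ≤ p * Nat.card (ulmSubgroup p k G) := by
  have : Finite G := Finite.of_injective f hf
  set S : AddSubgroup H := (f.comp (nsmulAddMonoidHom (p ^ k))).range
  set φ : ulmSubgroup p k H →+ H ⧸ S := (QuotientAddGroup.mk' S).comp (ulmSubgroup p k H).subtype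
  have hker : Nat.card φ.ker ≤ Nat.card (ulmSubgroup p k G) := by
    have h (z : φ.ker) : ∃ x : ulmSubgroup p k G, f x = z.1.1 := by
      have hz : (z.1.1 : H) ∈ S := (QuotientAddGroup.eq_zero_iff _).1 z.2
      obtain ⟨x, hx⟩ := hz
      replace hx : f (p ^ k • x) = z.1.1 := hx
      refine ⟨⟨p ^ k • x, mem_ulmSubgroup.2 ⟨⟨x, rfl⟩, hf ?_⟩⟩, hx⟩
      rw [map_nsmul, hx, map_zero]
      exact (mem_ulmSubgroup.1 z.1.2).2
    choose g hg using h
    refine Nat.card_le_card_of_injective g fun x y hxy ↦ ?_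
    exact Subtype.ext (Subtype.ext (by rw [← hg, ← hg, hxy]))
  have hrange : Nat.card φ.range ≤ p := by
    set C := AddSubgroup.zmultiples (QuotientAddGroup.mk' S (p ^ k • e))
    have hC (q : φ.range) : q.1 ∈ C ∧ p • q.1 = 0 := by
      obtain ⟨_, ⟨⟨z, hz⟩, rfl⟩⟩ := q
      obtain ⟨⟨y, rfl⟩, hz0⟩ := mem_ulmSubgroup.1 hz
      constructor
      · obtain ⟨x, n, rfl⟩ := he y
        refine AddSubgroup.mem_zmultiples_iff.2 ⟨n, ?_⟩
        change n • QuotientAddGroup.mk' S (p ^ k • e) =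
          QuotientAddGroup.mk' S (p ^ k • (f x + n • e))
        have : QuotientAddGroup.mk' S (p ^ k • f x) = 0 :=
          (QuotientAddGroup.eq_zero_iff _).2 ⟨x, by simp⟩
        rw [smul_add, map_add, this, zero_add, ← map_zsmul, smul_comm]
      · change p • QuotientAddGroup.mk' S (p ^ k • y) = 0
        rw [← map_nsmul, hz0, map_zero]
    have hle : Nat.card φ.range ≤ Nat.card (nsmulAddMonoidHom p : C →+ C).ker := by
      refine Nat.card_le_card_of_injective
        (fun q ↦ ⟨⟨q.1, (hC q).1⟩, Subtype.ext (hC q).2⟩) fun q r hqr ↦ ?_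
      exact Subtype.ext (congrArg (fun x ↦ x.1.1) hqr)
    rw [IsAddCyclic.card_nsmulAddMonoidHom_ker] at hle
    exact hle.trans (Nat.gcd_le_right _ hp)
  rw [AddSubgroup.card_eq_card_quotient_mul_card_addSubgroup φ.ker,
    Nat.card_congr (QuotientAddGroup.quotientKerEquivRange φ).toEquiv]
  exact Nat.mul_le_mul hrange hker

lemma card_ulmSubgroup_congr {p k : ℕ} {G H : Type*} [AddCommGroup G] [AddCommGroup H]
    [Finite H] (e : G ≃+ H) : Nat.card (ulmSubgroup p k G) = Nat.card (ulmSubgroup p k H) :=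
  have : Finite G := Finite.of_equiv _ e.symm.toEquiv
  (card_ulmSubgroup_le_of_injective e.toAddMonoidHom e.injective).antisymm
    (card_ulmSubgroup_le_of_injective e.symm.toAddMonoidHom e.symm.injective)

lemma card_ulmSubgroup_zmod {p : ℕ} (hp : p.Prime) (k a : ℕ) :
    Nat.card (ulmSubgroup p k (ZMod (p ^ a))) = if k < a then p else 1 := by
  have : NeZero (p ^ a) := ⟨pow_ne_zero _ hp.ne_zero⟩
  split_ifs with h
  · have hker : ulmSubgroup p k (ZMod (p ^ a)) = (nsmulAddMonoidHom p).ker := by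
      refine inf_eq_right.2 fun x hx ↦ ?_
      obtain ⟨b, rfl⟩ : ∃ b, a = k + 1 + b := ⟨a - (k + 1), by omega⟩
      replace hx : p • x = 0 := hx
      obtain ⟨n, rfl⟩ := ZMod.natCast_zmod_surjective x
      rw [nsmul_eq_mul, ← Nat.cast_mul, ZMod.natCast_eq_zero_iff] at hx
      have hx' : p ^ k ∣ n := by
        refine Nat.dvd_of_mul_dvd_mul_left hp.pos (dvd_trans ⟨p ^ b, ?_⟩ hx)
        ring
      obtain ⟨c, rfl⟩ := hx'
      exact ⟨(c : ZMod _), by simp⟩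
    rw [hker, IsAddCyclic.card_nsmulAddMonoidHom_ker, Nat.card_zmod]
    exact Nat.gcd_eq_right (dvd_pow_self p (by omega))
  · have hbot : ulmSubgroup p k (ZMod (p ^ a)) = ⊥ := by
      rw [eq_bot_iff]
      intro x hx
      obtain ⟨⟨y, rfl⟩, -⟩ := mem_ulmSubgroup.1 hx
      obtain ⟨b, rfl⟩ : ∃ b, k = a + b := ⟨k - a, by omega⟩
      have : ((p ^ a : ℕ) : ZMod (p ^ a)) = 0 := ZMod.natCast_self _
      rw [AddSubgroup.mem_bot, nsmul_eq_mul, pow_add, Nat.cast_mul, this, zero_mul, zero_mul]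
    rw [hbot, AddSubgroup.card_bot]

lemma card_ulmSubgroup_pi {ι : Type*} [Fintype ι] (p k : ℕ) (H : ι → Type*)
    [∀ i, AddCommGroup (H i)] :
    Nat.card (ulmSubgroup p k (∀ i, H i)) = ∏ i, Nat.card (ulmSubgroup p k (H i)) := by
  have h (x : ∀ i, H i) :
      x ∈ ulmSubgroup p k (∀ i, H i) ↔ ∀ i, x i ∈ ulmSubgroup p k (H i) := by
    simp only [mem_ulmSubgroup, funext_iff, Pi.smul_apply, Pi.zero_apply]
    exact ⟨fun h i ↦ ⟨⟨h.1.choose i, h.1.choose_spec i⟩, h.2 i⟩, fun h ↦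
      ⟨⟨fun i ↦ (h i).1.choose, fun i ↦ (h i).1.choose_spec⟩, fun i ↦ (h i).2⟩⟩
  rw [← Nat.card_pi]
  exact Nat.card_congr ((Equiv.subtypeEquivRight h).trans Equiv.subtypePiEquivPi)

lemma card_ulmSubgroup_pi_zmod {p : ℕ} (hp : p.Prime) {ι : Type*} [Fintype ι] (a : ι → ℕ)
    (k : ℕ) : Nat.card (ulmSubgroup p k (∀ i, ZMod (p ^ a i))) =
      p ^ ((Finset.univ.val.map a).countP (k < ·)) := by
  simp_rw [card_ulmSubgroup_pi, card_ulmSubgroup_zmod hp, Finset.prod_ite, Finset.prod_const,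
    one_pow, mul_one, Multiset.countP_map]
  rfl

lemma exists_addEquiv_pi_zmod {p : ℕ} (hp : p.Prime) {G : Type*} [AddCommGroup G]
    [Module.Finite ℤ G] (hG : ∀ x : G, ∃ j : ℕ, p ^ j • x = 0) :
    ∃ (d : ℕ) (a : Fin d → ℕ), Nonempty (G ≃+ ∀ i, ZMod (p ^ a i)) := by
  have hT : Module.IsTorsion' G (Submonoid.powers (p : ℤ)) := by
    rw [Submodule.isTorsion'_powers_iff]
    intro x
    obtain ⟨j, hj⟩ := hG x
    exact ⟨j, by exact_mod_cast hj⟩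
  obtain ⟨d, a, ⟨e⟩⟩ := Module.torsion_by_prime_power_decomposition
    (Nat.prime_iff_prime_int.1 hp).irreducible hT
  refine ⟨d, a, ⟨e.toAddEquiv.trans ((DirectSum.addEquivProd _).trans
    (AddEquiv.piCongrRight fun i ↦ ?_))⟩⟩
  exact ((Ideal.quotEquivOfEq (by simp [Ideal.submodule_span_eq])).trans
    (Int.quotientSpanNatEquivZMod (p ^ a i))).toAddEquiv

lemma nonempty_pi_zmod_addEquiv_of_map_eq (p : ℕ) {ι κ : Type*} [Fintype ι] [Fintype κ]
    (a : ι → ℕ) (b : κ → ℕ) (h : Finset.univ.val.map a = Finset.univ.val.map b) :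
    Nonempty ((∀ i, ZMod (p ^ a i)) ≃+ ∀ j, ZMod (p ^ b j)) := by
  classical
  have hc (c : ℕ) : Nonempty ({i // a i = c} ≃ {j // b j = c}) := by
    refine ⟨Fintype.equivOfCardEq ?_⟩
    have := congrArg (Multiset.count c) h
    rw [Multiset.count_map, Multiset.count_map] at this
    simp_rw [Fintype.card_subtype, eq_comm (b := c)]
    exact this
  let e : ι ≃ κ := Equiv.ofFiberEquiv fun c ↦ (hc c).some
  have he : a = b ∘ e := funext fun i ↦ (Equiv.ofFiberEquiv_map _ i).symm
  clear_value e
  subst he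
  exact ⟨(RingEquiv.piCongrLeft (fun j ↦ ZMod (p ^ b j)) e).toAddEquiv⟩

lemma Multiset.map_univ_sumElim {ι κ α : Type*} [Fintype ι] [Fintype κ] (a : ι → α) (b : κ → α) :
    (Finset.univ : Finset (ι ⊕ κ)).val.map (Sum.elim a b) =
      Finset.univ.val.map a + Finset.univ.val.map b := by
  rw [← Finset.univ_disjSum_univ, Finset.val_disjSum, Multiset.disjSum, Multiset.map_add,
    Multiset.map_map, Multiset.map_map]
  rfl

lemma List.map_univ_getD {α : Type*} (L : List α) (d : α) :
    (Finset.univ : Finset (Fin L.length)).val.map (fun i ↦ L.getD i.1 d) = (L : Multiset α) := by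
  simp

lemma List.lt_getElem_iff_le_countP {L : List ℕ} (hL : L.Pairwise (· ≤ ·)) (v : ℕ) {i : ℕ}
    (hi : i < L.length) : v < L[i] ↔ L.length - i ≤ L.countP (v < ·) := by
  induction L generalizing i with
  | nil => simp at hi
  | cons x L ih =>
    obtain ⟨hx, hL'⟩ := List.pairwise_cons.1 hL
    by_cases hv : v < x
    · have hall : ∀ y ∈ x :: L, v < y := by
        intro y hy
        rcases List.mem_cons.1 hy with rfl | hy
        · exact hv
        · exact hv.trans_le (hx y hy)
      have hc : (x :: L).countP (v < ·) = (x :: L).length :=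
        List.countP_eq_length.2 fun y hy ↦ by simpa using hall y hy
      rw [hc]
      exact iff_of_true (hall _ (List.getElem_mem hi)) (Nat.sub_le _ _)
    · have hle : L.countP (v < ·) ≤ L.length := List.countP_le_length
      rw [List.countP_cons_of_neg (by simpa using hv), List.length_cons]
      cases i with
      | zero => exact iff_of_false hv (by omega)
      | succ i =>
        rw [List.getElem_cons_succ, ih hL' (by simpa using hi), Nat.add_sub_add_right]

lemma List.strictly_interleave_of_countP_le {L M : List ℕ} (hL : L.Pairwise (· ≤ ·))
    (hM : M.Pairwise (· ≤ ·)) (hlen : L.length = M.length) (hdisj : ∀ x ∈ L, x ∉ M)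
    (hle : ∀ v, L.countP (v < ·) ≤ M.countP (v < ·))
    (hle' : ∀ v, M.countP (v < ·) ≤ L.countP (v < ·) + 1) :
    (∀ i < L.length, L.getD i 0 < M.getD i 0) ∧
      ∀ i, i + 1 < L.length → M.getD i 0 < L.getD (i + 1) 0 := by
  have hne {i j : ℕ} (hi : i < L.length) (hj : j < M.length) : L[i] ≠ M[j] := fun h ↦
    hdisj _ (List.getElem_mem hi) (h ▸ List.getElem_mem hj)
  constructor
  · intro i hi
    have hi' : i < M.length := hlen ▸ hi
    rw [List.getD_eq_getElem _ _ hi, List.getD_eq_getElem _ _ hi']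
    refine lt_of_le_of_ne (le_of_not_gt fun h ↦ lt_irrefl M[i] ?_) (hne _ _)
    have h1 := (List.lt_getElem_iff_le_countP hL _ hi).1 h
    have h2 := hle M[i]
    exact (List.lt_getElem_iff_le_countP hM _ hi').2 (by omega)
  · intro i hi
    have hi' : i < M.length := by omega
    rw [List.getD_eq_getElem _ _ hi, List.getD_eq_getElem _ _ hi']
    refine lt_of_le_of_ne (le_of_not_gt fun h ↦ lt_irrefl L[i + 1] ?_) (hne _ _).symm
    have h1 := (List.lt_getElem_iff_le_countP hM _ hi').1 h
    have h2 := hle' L[i + 1]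
    exact (List.lt_getElem_iff_le_countP hL _ hi).2 (by omega)

lemma Multiset.strictly_interleave_sort {A B : Multiset ℕ} (hcard : A.card = B.card)
    (hdisj : Disjoint A B) (hle : ∀ v, A.countP (v < ·) ≤ B.countP (v < ·))
    (hle' : ∀ v, B.countP (v < ·) ≤ A.countP (v < ·) + 1) :
    (∀ i < A.card, A.sort.getD i 0 < B.sort.getD i 0) ∧
      ∀ i, i + 1 < A.card → B.sort.getD i 0 < A.sort.getD (i + 1) 0 := by
  have hc (C : Multiset ℕ) (v : ℕ) : C.countP (v < ·) = C.sort.countP (v < ·) := by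
    conv_lhs => rw [← C.sort_eq (· ≤ ·), Multiset.coe_countP]
  simp_rw [hc] at hle hle'
  rw [← Multiset.length_sort (s := A) (r := (· ≤ ·))]
  refine List.strictly_interleave_of_countP_le (A.pairwise_sort _) (B.pairwise_sort _) ?_ ?_
    hle hle'
  · simpa using hcard
  · simpa using fun x ↦ Multiset.disjoint_left.1 hdisj

lemma Multiset.exists_strictly_interleaving {A B : Multiset ℕ} (hcard : A.card = B.card)
    (hle : ∀ v, A.countP (v < ·) ≤ B.countP (v < ·))
    (hle' : ∀ v, B.countP (v < ·) ≤ A.countP (v < ·) + 1) :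
    ∃ N K K' : List ℕ, A = (N : Multiset ℕ) + (K : Multiset ℕ) ∧
      B = (N : Multiset ℕ) + (K' : Multiset ℕ) ∧ K.length = K'.length ∧
      (∀ i < K.length, K.getD i 0 < K'.getD i 0) ∧
      ∀ i, i + 1 < K.length → K'.getD i 0 < K.getD (i + 1) 0 := by
  have hAN : A ∩ B + (A - B) = A := by rw [add_comm, Multiset.sub_add_inter]
  have hBN : A ∩ B + (B - A) = B := by rw [add_comm, Multiset.inter_comm, Multiset.sub_add_inter]
  have hcA (v : ℕ) := congrArg (Multiset.countP (v < ·)) hAN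
  have hcB (v : ℕ) := congrArg (Multiset.countP (v < ·)) hBN
  have hcardA := congrArg Multiset.card hAN
  have hcardB := congrArg Multiset.card hBN
  simp only [Multiset.countP_add, Multiset.card_add] at hcA hcB hcardA hcardB
  have hcard' : (A - B).card = (B - A).card := by omega
  have hdisj : Disjoint (A - B) (B - A) := by
    rw [Multiset.disjoint_left]
    intro x hx hx'
    have h1 := Multiset.mem_sub.1 hx
    have h2 := Multiset.mem_sub.1 hx'
    omega
  obtain ⟨h1, h2⟩ := Multiset.strictly_interleave_sort hcard' hdisj
    (fun v ↦ by have := hle v; have := hcA v; have := hcB v; omega)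
    (fun v ↦ by have := hle' v; have := hcA v; have := hcB v; omega)
  refine ⟨(A ∩ B).sort, (A - B).sort, (B - A).sort, ?_, ?_, ?_, ?_, ?_⟩
  · rw [Multiset.sort_eq, Multiset.sort_eq, hAN]
  · rw [Multiset.sort_eq, Multiset.sort_eq, hBN]
  · rw [Multiset.length_sort, Multiset.length_sort, hcard']
  · rwa [Multiset.length_sort]
  · rwa [Multiset.length_sort]

lemma card_ulmSubgroup_of_addEquiv {p : ℕ} (hp : p.Prime) {G : Type*} [AddCommGroup G] {d : ℕ}
    (a : Fin d → ℕ) (e : G ≃+ ∀ i, ZMod (p ^ a i)) (d' v : ℕ) :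
    Nat.card (ulmSubgroup p v G) =
      p ^ (Finset.univ.val.map a + Multiset.replicate d' 0).countP (v < ·) := by
  have : NeZero p := ⟨hp.ne_zero⟩
  rw [card_ulmSubgroup_congr e, card_ulmSubgroup_pi_zmod hp, Multiset.countP_add,
    (Multiset.countP_eq_zero (s := Multiset.replicate d' 0)).2, add_zero]
  intro x hx
  simp [Multiset.eq_of_mem_replicate hx]

lemma nonempty_addEquiv_pi_zmod_prod (p : ℕ) {G : Type*} [AddCommGroup G] {d d' : ℕ}
    (a : Fin d → ℕ) (e : G ≃+ ∀ i, ZMod (p ^ a i)) (L M : List ℕ)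
    (h : Finset.univ.val.map a + Multiset.replicate d' 0 = (L : Multiset ℕ) + (M : Multiset ℕ)) {m s : ℕ}
    (hm : L.length = m) (hs : M.length = s) :
    Nonempty (G ≃+ ((∀ i : Fin m, ZMod (p ^ L.getD i.1 0)) ×
      (∀ i : Fin s, ZMod (p ^ M.getD i.1 0)))) := by
  subst hm hs
  have hsum {κ κ' : Type} (b : κ → ℕ) (c : κ' → ℕ) :
      (∀ i, ZMod (p ^ Sum.elim b c i)) ≃+ ((∀ i, ZMod (p ^ b i)) × ∀ i, ZMod (p ^ c i)) :=
    (LinearEquiv.sumPiEquivProdPi ℤ κ κ' fun i ↦ ZMod (p ^ Sum.elim b c i)).toAddEquiv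
  obtain ⟨f⟩ := nonempty_pi_zmod_addEquiv_of_map_eq p
    (Sum.elim a (fun _ : Fin d' ↦ 0))
    (Sum.elim (fun i : Fin L.length ↦ L.getD i.1 0) (fun i : Fin M.length ↦ M.getD i.1 0))
    (by rw [Multiset.map_univ_sumElim, Multiset.map_univ_sumElim, List.map_univ_getD,
          List.map_univ_getD, ← h]
        simp)
  have : Subsingleton (ZMod (p ^ 0)) := by rw [pow_zero]; infer_instance
  have : Unique (Fin d' → ZMod (p ^ 0)) := { default := 0, uniq := fun _ ↦ Subsingleton.elim _ _ }
  exact ⟨e.trans (AddEquiv.prodUnique.symm.trans ((hsum _ _).symm.trans (f.trans (hsum _ _))))⟩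

lemma DoubleStarPair.of_cyclic_extension {p : ℕ} (hp : p.Prime) {G H : Type*} [AddCommGroup G]
    [AddCommGroup H] [Finite G] [Module.Finite ℤ H] (hG : ∀ x : G, ∃ j : ℕ, p ^ j • x = 0)
    (hH : ∀ x : H, ∃ j : ℕ, p ^ j • x = 0) (f : G →+ H) (hf : Function.Injective f) (e : H)
    (he : ∀ h : H, ∃ (x : G) (n : ℤ), h = f x + n • e) (hne : ¬ Nonempty (H ≃+ G)) :
    DoubleStarPair p G H := by
  obtain ⟨d, a, ⟨eG⟩⟩ := exists_addEquiv_pi_zmod hp hG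
  obtain ⟨d', b, ⟨eH⟩⟩ := exists_addEquiv_pi_zmod hp hH
  have : NeZero p := ⟨hp.ne_zero⟩
  have : Finite H := Finite.of_equiv _ eH.symm.toEquiv
  have hcA := card_ulmSubgroup_of_addEquiv hp a eG d'
  have hcB := card_ulmSubgroup_of_addEquiv hp b eH d
  obtain ⟨N, K, K', hA, hB, hlen, h1, h2⟩ := Multiset.exists_strictly_interleaving
    (A := Finset.univ.val.map a + Multiset.replicate d' 0)
    (B := Finset.univ.val.map b + Multiset.replicate d 0) (by simp [add_comm])
    (fun v ↦ by
      rw [← Nat.pow_le_pow_iff_right hp.one_lt, ← hcA, ← hcB]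
      exact card_ulmSubgroup_le_of_injective f hf)
    (fun v ↦ by
      rw [← Nat.pow_le_pow_iff_right hp.one_lt, pow_succ', ← hcA, ← hcB]
      exact card_ulmSubgroup_le_mul_of_cyclic_quotient hp.pos f hf e he)
  have hG' := nonempty_addEquiv_pi_zmod_prod p a eG N K hA rfl rfl
  have hH' := nonempty_addEquiv_pi_zmod_prod p b eH N K' hB rfl hlen.symm
  refine Or.inr ⟨N.length, fun i ↦ N.getD i 0, K.length, fun i ↦ K.getD i 0,
    fun i ↦ K'.getD i 0, ?_, hG', hH', h1, h2⟩
  rw [Nat.one_le_iff_ne_zero]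
  intro h0
  obtain rfl := List.length_eq_zero_iff.1 h0
  obtain rfl := List.length_eq_zero_iff.1 (hlen ▸ h0)
  exact hne ⟨hH'.some.trans hG'.some.symm⟩

/-- For a finite abelian `p`-group `G`, `g ∈ G` and `l ≥ 1`, the pair
`(G, (G ⊕ ℤ) ⧸ ⟨(g, p^l)⟩)` satisfies condition (**); in particular the quotient is
never isomorphic to `G`. -/
theorem stmt14 {p : ℕ} (hp : p.Prime) {G : Type*} [AddCommGroup G] [Finite G]
    (hpG : ∀ x : G, ∃ j : ℕ, p ^ j • x = 0) (g : G) (l : ℕ) (hl : 1 ≤ l) :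
    DoubleStarPair p G ((G × ℤ) ⧸ AddSubgroup.zmultiples ((g, (p : ℤ) ^ l) : G × ℤ)) ∧
      ¬ Nonempty (((G × ℤ) ⧸ AddSubgroup.zmultiples ((g, (p : ℤ) ^ l) : G × ℤ)) ≃+ G) := by
  set S := AddSubgroup.zmultiples ((g, (p : ℤ) ^ l) : G × ℤ) with hS
  have hmem (x : G) (n : ℤ) : (x, n) ∈ S ↔ ∃ c : ℤ, c • g = x ∧ c * (p : ℤ) ^ l = n := by
    simp [hS, AddSubgroup.mem_zmultiples_iff]
  have hpl : (p : ℤ) ^ l ≠ 0 := pow_ne_zero _ (by exact_mod_cast hp.ne_zero)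
  let π : G × ℤ →+ (G × ℤ) ⧸ S := QuotientAddGroup.mk' S
  have hπ (x : G × ℤ) : π x = 0 ↔ x ∈ S := QuotientAddGroup.eq_zero_iff x
  let f : G →+ (G × ℤ) ⧸ S := π.comp (AddMonoidHom.inl G ℤ)
  have hf : Function.Injective f := by
    refine (injective_iff_map_eq_zero f).2 fun x hx ↦ ?_
    obtain ⟨c, rfl, hc⟩ := (hmem _ _).1 ((hπ (x, 0)).1 hx)
    rw [(mul_eq_zero.1 hc).resolve_right hpl, zero_smul]
  have he (h : (G × ℤ) ⧸ S) : ∃ (x : G) (n : ℤ), h = f x + n • π (0, 1) := by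
    obtain ⟨⟨x, n⟩, rfl⟩ := QuotientAddGroup.mk'_surjective S h
    refine ⟨x, n, ?_⟩
    change π (x, n) = π (x, 0) + n • π (0, 1)
    rw [← map_zsmul, ← map_add]
    simp
  have hne : ¬ Nonempty (((G × ℤ) ⧸ S) ≃+ G) := by
    rintro ⟨e⟩
    have hsurj : Function.Surjective f := by
      have := Finite.surjective_of_injective (e.injective.comp hf)
      exact fun y ↦ (this (e y)).imp fun x hx ↦ e.injective hx
    obtain ⟨x, hx⟩ := hsurj (π (0, 1))
    replace hx : π ((0, 1) - (x, 0)) = 0 := by rw [map_sub, ← hx]; exact sub_self _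
    rw [hπ, Prod.mk_sub_mk, hmem] at hx
    obtain ⟨c, -, hc⟩ := hx
    have hdvd : (p : ℤ) ∣ 1 :=
      (dvd_pow_self (p : ℤ) (by omega : l ≠ 0)).trans ⟨c, by rw [mul_comm, hc, sub_zero]⟩
    exact hp.one_lt.ne' (Nat.dvd_one.1 (by exact_mod_cast hdvd))
  refine ⟨DoubleStarPair.of_cyclic_extension hp hpG (fun y ↦ ?_) f hf _ he hne, hne⟩
  obtain ⟨⟨x, n⟩, rfl⟩ := QuotientAddGroup.mk'_surjective S y
  obtain ⟨j, hj⟩ := hpG x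
  obtain ⟨i, hi⟩ := hpG g
  refine ⟨l + i + j, ?_⟩
  change p ^ (l + i + j) • π (x, n) = 0
  rw [← map_nsmul, hπ, Prod.smul_mk, hmem]
  refine ⟨((n * p ^ j : ℤ)) * (p ^ i : ℕ), ?_, ?_⟩
  · rw [mul_smul, natCast_zsmul, hi, smul_zero, pow_add, mul_smul, hj, smul_zero]
  · push_cast [nsmul_eq_mul]
    ring
end

section
/- Let T and T̃ be finite abelian groups and n > 0 an integer. If there exists (t, n) ∈ T ⊕ ℤ with T̃ ≅ (T ⊕ ℤ)/⟨(t, n)⟩, then there exists t̃ ∈ T̃ with T ≅ T̃/⟨t̃⟩, and such t̃ is unique up to automorphisms of T̃. Conversely, if there exists t̃ ∈ T̃ with T ≅ T̃/⟨t̃⟩, then there exist t ∈ T and an integer n > 0 with T̃ ≅ (T ⊕ ℤ)/⟨(t, n)⟩. -/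
theorem AddSubgroup.eq_of_card_eq_of_isAddCyclic {G : Type*} [AddCommGroup G] [Finite G]
    [IsAddCyclic G] {H K : AddSubgroup G} (h : Nat.card H = Nat.card K) : H = K := by
  classical
  have := Fintype.ofFinite G
  have key : ∀ L : AddSubgroup G,
      (L : Set G) = {x : G | Nat.card L • x = 0} := by
    intro L
    refine Set.eq_of_subset_of_ncard_le (fun x hx => ?_) ?_
    · exact congrArg Subtype.val (card_nsmul_eq_zero' (x := (⟨x, hx⟩ : L)))
    · have := IsAddCyclic.card_nsmul_eq_zero_le (α := G) (n := Nat.card L) Nat.card_pos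
      rw [← Set.ncard_coe_finset, Finset.coe_filter] at this
      simpa only [Finset.mem_univ, true_and] using! this
  exact SetLike.coe_injective (by rw [key H, key K, h])

section Orbit

variable {A : Type*} [AddCommGroup A]

/-- Homomorphisms killing `a` are the homomorphisms out of `A ⧸ ⟨a⟩`. -/
def AddMonoidHom.killEquivQuotient (a : A) (B : Type*) [AddCommGroup B] :
    {f : A →+ B // f a = 0} ≃ ((A ⧸ AddSubgroup.zmultiples a) →+ B) where
  toFun f := QuotientAddGroup.lift _ f.1 (by
    simpa [AddSubgroup.zmultiples_le] using f.2)
  invFun g := ⟨g.comp (QuotientAddGroup.mk' _), by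
    have : ((a : A) : A ⧸ AddSubgroup.zmultiples a) = 0 :=
      (QuotientAddGroup.eq_zero_iff a).2 (AddSubgroup.mem_zmultiples a)
    simp [this]⟩
  left_inv f := by ext; rfl
  right_inv g := by ext; rfl

variable {a b : A}
  (h : Nonempty ((A ⧸ AddSubgroup.zmultiples a) ≃+ (A ⧸ AddSubgroup.zmultiples b)))

include h

theorem AddMonoidHom.card_kill_eq (B : Type*) [AddCommGroup B] :
    Nat.card {f : A →+ B // f a = 0} = Nat.card {f : A →+ B // f b = 0} := by
  obtain ⟨e⟩ := h
  exact Nat.card_congr (((killEquivQuotient a B).trans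
    e.addMonoidHomCongrLeft.toEquiv).trans (killEquivQuotient b B).symm)

variable [Finite A]

theorem AddMonoidHom.card_range_eval_eq (B : Type*) [AddCommGroup B] [Finite B] :
    Nat.card (eval a : (A →+ B) →+ B).range = Nat.card (eval b : (A →+ B) →+ B).range := by
  have key : ∀ x : A, Nat.card {f : A →+ B // f x = 0} *
      Nat.card (eval x : (A →+ B) →+ B).range = Nat.card (A →+ B) := by
    intro x
    rw [← AddSubgroup.index_ker, ← AddSubgroup.card_mul_index (eval x : (A →+ B) →+ B).ker]
    rfl
  have : Finite (A →+ B) := DFunLike.finite _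
  have : Nonempty {f : A →+ B // f a = 0} := ⟨⟨0, rfl⟩⟩
  have ha := key a
  rw [← key b, ← card_kill_eq h B] at ha
  exact Nat.eq_of_mul_eq_mul_left Nat.card_pos ha

theorem AddMonoidHom.exists_apply_eq_of_exists_apply_eq {B : Type*} [AddCommGroup B] [Finite B]
    {c : B} (hc : ∃ f : A →+ B, f a = c) : ∃ f : A →+ B, f b = c := by
  classical
  obtain ⟨f, rfl⟩ := hc
  obtain ⟨ι, _, n, hn, ⟨e⟩⟩ := AddCommGroup.equiv_directSum_zmod_of_finite' B
  have : ∀ i, NeZero (n i) := fun i => ⟨by have := hn i; omega⟩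
  let e' := e.trans (DirectSum.addEquivProd fun i => ZMod (n i))
  have hg : ∀ i, ∃ g : A →+ ZMod (n i), g b = e' (f a) i := by
    intro i
    have hr := AddSubgroup.eq_of_card_eq_of_isAddCyclic (card_range_eval_eq h (ZMod (n i)))
    have hm : e' (f a) i ∈ (eval a : (A →+ ZMod (n i)) →+ ZMod (n i)).range :=
      ⟨(Pi.evalAddMonoidHom _ i).comp (e'.toAddMonoidHom.comp f), rfl⟩
    rw [hr] at hm
    exact hm
  choose g hg using hg
  refine ⟨e'.symm.toAddMonoidHom.comp (AddMonoidHom.mk' (fun x i => g i x) ?_), ?_⟩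
  · intro x y; ext i; simp
  · have : (fun i => g i b) = e' (f a) := funext hg
    simp [this]

theorem AddMonoidHom.card_apply_eq {B : Type*} [AddCommGroup B] [Finite B] (c : B) :
    Nat.card {f : A →+ B // f a = c} = Nat.card {f : A →+ B // f b = c} := by
  have shift : ∀ (x : A) (f₀ : A →+ B), f₀ x = c →
      Nat.card {f : A →+ B // f x = c} = Nat.card {f : A →+ B // f x = 0} := by
    intro x f₀ hf₀
    refine Nat.card_congr ((Equiv.subRight f₀).subtypeEquiv fun f => ?_)
    simp [sub_eq_zero, hf₀]
  by_cases hc : ∃ f : A →+ B, f a = c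
  · obtain ⟨g, hg⟩ := exists_apply_eq_of_exists_apply_eq h hc
    obtain ⟨f, hf⟩ := hc
    rw [shift a f hf, shift b g hg, card_kill_eq h B]
  · have hc' : ¬ ∃ f : A →+ B, f b = c := fun h' =>
      hc (exists_apply_eq_of_exists_apply_eq (h.map AddEquiv.symm) h')
    have : IsEmpty {f : A →+ B // f a = c} := ⟨fun f => hc ⟨f.1, f.2⟩⟩
    have : IsEmpty {f : A →+ B // f b = c} := ⟨fun f => hc' ⟨f.1, f.2⟩⟩
    simp

theorem AddMonoidHom.card_range_le_apply_eq {B : Type*} [AddCommGroup B] [Finite B] (c : B)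
    (H : AddSubgroup B) : Nat.card {f : A →+ B // f.range ≤ H ∧ f a = c} =
      Nat.card {f : A →+ B // f.range ≤ H ∧ f b = c} := by
  by_cases hc : c ∈ H
  · have key : ∀ x : A, Nat.card {f : A →+ B // f.range ≤ H ∧ f x = c} =
        Nat.card {f : A →+ H // f x = ⟨c, hc⟩} := by
      intro x
      refine Nat.card_congr
        { toFun := fun f => ⟨f.1.codRestrict H fun y => f.2.1 ⟨y, rfl⟩, Subtype.ext f.2.2⟩
          invFun := fun g => ⟨H.subtype.comp g.1, ?_, by simp [g.2]⟩
          left_inv := fun f => by ext; rfl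
          right_inv := fun g => by ext; rfl }
      rintro _ ⟨y, rfl⟩
      exact (g.1 y).2
    rw [key, key, card_apply_eq h]
  · have key : ∀ x : A, IsEmpty {f : A →+ B // f.range ≤ H ∧ f x = c} := fun x =>
      ⟨fun f => hc (f.2.1 ⟨x, f.2.2⟩)⟩
    have := key a
    have := key b
    simp

theorem AddMonoidHom.card_range_eq_apply_eq {B : Type*} [AddCommGroup B] [Finite B] (c : B)
    (H : AddSubgroup B) : Nat.card {f : A →+ B // f.range = H ∧ f a = c} =
      Nat.card {f : A →+ B // f.range = H ∧ f b = c} := by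
  classical
  have : Finite (A →+ B) := DFunLike.finite _
  induction H using WellFoundedLT.induction with
  | ind H ih =>
  have split : ∀ x : A, Nat.card {f : A →+ B // f.range ≤ H ∧ f x = c} =
      Nat.card {f : A →+ B // f.range = H ∧ f x = c} +
        ∑ᶠ K : {K : AddSubgroup B // K < H}, Nat.card {f : A →+ B // f.range = K ∧ f x = c} := by
    intro x
    have := Fintype.ofFinite {K : AddSubgroup B // K < H}
    rw [finsum_eq_sum_of_fintype, ← Nat.card_sigma, ← Nat.card_sum]
    refine Nat.card_congr
      { toFun := fun f => if hf : f.1.range = H then .inl ⟨f.1, hf, f.2.2⟩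
          else .inr ⟨⟨f.1.range, lt_of_le_of_ne f.2.1 hf⟩, f.1, rfl, f.2.2⟩
        invFun := Sum.elim (fun f => ⟨f.1, f.2.1.le, f.2.2⟩)
          (fun f => ⟨f.2.1, f.2.2.1.le.trans f.1.2.le, f.2.2.2⟩)
        left_inv := fun f => by dsimp only; split_ifs <;> rfl
        right_inv := ?_ }
    rintro (⟨f, hfH, hf⟩ | ⟨⟨K, hK⟩, f, hfK, hf⟩)
    · simp [hfH]
    · obtain rfl : f.range = K := hfK
      simp [hK.ne]
  have hle := card_range_le_apply_eq h c H
  rw [split a, split b, finsum_congr fun K : {K : AddSubgroup B // K < H} => ih K.1 K.2] at hle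
  exact Nat.add_right_cancel hle

/-- In a finite abelian group, elements generating cyclic subgroups with isomorphic quotients lie
in the same orbit of the automorphism group. -/
theorem AddEquiv.exists_apply_eq_of_quotient_zmultiples_equiv : ∃ e : A ≃+ A, e a = b := by
  have : Nonempty {f : A →+ A // f.range = ⊤ ∧ f a = b} := by
    refine (Nat.card_pos_iff.1 ?_).1
    rw [AddMonoidHom.card_range_eq_apply_eq h]
    have : Finite (A →+ A) := DFunLike.finite _
    have : Nonempty {f : A →+ A // f.range = ⊤ ∧ f b = b} :=
      ⟨AddMonoidHom.id A, AddMonoidHom.range_eq_top.2 Function.surjective_id, rfl⟩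
    exact Nat.card_pos
  obtain ⟨f, hf, hab⟩ := this
  have hs := AddMonoidHom.range_eq_top.1 hf
  exact ⟨AddEquiv.ofBijective f ⟨Finite.injective_iff_surjective.2 hs, hs⟩, hab⟩

end Orbit

section Duality

theorem hasEnoughRootsOfUnity_complex_exponent (G : Type*) [CommGroup G] [Finite G] :
    HasEnoughRootsOfUnity ℂ (Monoid.exponent G) :=
  have : NeZero (Monoid.exponent G) := ⟨Monoid.exponent_ne_zero_of_finite⟩
  inferInstance

attribute [local instance] hasEnoughRootsOfUnity_complex_exponent

variable {G : Type*} [CommGroup G] [Finite G]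

theorem CommGroup.exists_mulEquiv_quotient_zpowers (H : Subgroup G) [IsCyclic (G ⧸ H)] :
    ∃ g : G, Nonempty (H ≃* G ⧸ Subgroup.zpowers g) := by
  let r := MonoidHom.domRestrictHom H ℂˣ
  obtain ⟨e⟩ := CommGroup.monoidHom_mulEquiv_of_hasEnoughRootsOfUnity G ℂ
  obtain ⟨eH⟩ := CommGroup.monoidHom_mulEquiv_of_hasEnoughRootsOfUnity H ℂ
  obtain ⟨eQ⟩ := CommGroup.monoidHom_mulEquiv_of_hasEnoughRootsOfUnity (G ⧸ H) ℂ
  have hcyc : IsCyclic r.ker :=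
    ((MonoidHom.domRestrictHomKerEquiv ℂˣ H).trans eQ).isCyclic.2 inferInstance
  obtain ⟨χ, hχ⟩ := (Subgroup.isCyclic_iff_exists_zpowers_eq_top r.ker).1 hcyc
  refine ⟨e χ, ⟨eH.symm.trans (MulEquiv.trans (QuotientGroup.quotientKerEquivOfSurjective r
    (MonoidHom.domRestrict_surjective ℂ H)).symm (QuotientGroup.congr _ _ e ?_))⟩⟩
  rw [← hχ]
  simp [MonoidHom.map_zpowers]

theorem CommGroup.exists_subgroup_mulEquiv_quotient_zpowers (g : G) :
    ∃ H : Subgroup G, IsCyclic (G ⧸ H) ∧ Nonempty (H ≃* G ⧸ Subgroup.zpowers g) := by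
  obtain ⟨e⟩ := CommGroup.monoidHom_mulEquiv_of_hasEnoughRootsOfUnity G ℂ
  obtain ⟨eQ⟩ := CommGroup.monoidHom_mulEquiv_of_hasEnoughRootsOfUnity (G ⧸ Subgroup.zpowers g) ℂ
  let r := MonoidHom.domRestrictHom (Subgroup.zpowers g) ℂˣ
  let K := r.ker
  let ev : (G →* ℂˣ) →* ℂˣ := MonoidHom.eval g
  have hK : K = ev.ker := by
    ext χ
    simp only [K, r, MonoidHom.mem_ker, MonoidHom.domRestrictHom_apply,
      MonoidHom.domRestrict_eq_one_iff, ev]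
    exact ⟨fun h => h g (Subgroup.mem_zpowers g), fun h x hx => by
      obtain ⟨k, rfl⟩ := Subgroup.mem_zpowers_iff.1 hx
      rw [map_zpow, show χ g = 1 from h, one_zpow]⟩
  have : Finite (G →* ℂˣ) := Finite.of_equiv _ e.symm.toEquiv
  have : Finite ev.range := Finite.of_surjective _ ev.rangeRestrict_surjective
  have hcyc : IsCyclic ((G →* ℂˣ) ⧸ K) := by
    exact ((QuotientGroup.quotientMulEquivOfEq hK).trans
      (QuotientGroup.quotientKerEquivRange ev)).isCyclic.2 inferInstance
  refine ⟨K.map e.toMonoidHom, (QuotientGroup.congr _ _ e rfl).isCyclic.1 hcyc, ⟨?_⟩⟩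
  exact (e.subgroupMap K).symm.trans
    ((MonoidHom.domRestrictHomKerEquiv ℂˣ _).trans eQ)


theorem CommGroup.exists_surjective_ker_eq_zpowers {N : Type*} [CommGroup N] (ι : N →* G)
    (hι : Function.Injective ι) (q : G) (hq : ∀ x : G, ∃ s : N, ∃ k : ℤ, ι s * q ^ k = x) :
    ∃ (f : G →* N) (g : G), Function.Surjective f ∧ f.ker = Subgroup.zpowers g := by
  have : IsCyclic (G ⧸ ι.range) := by
    refine ⟨q, fun y => ?_⟩
    obtain ⟨x, rfl⟩ := QuotientGroup.mk_surjective y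
    obtain ⟨s, k, rfl⟩ := hq x
    refine ⟨k, ?_⟩
    have : ((ι s : G) : G ⧸ ι.range) = 1 := (QuotientGroup.eq_one_iff _).2 ⟨s, rfl⟩
    simp [this]
  obtain ⟨g, ⟨e⟩⟩ := exists_mulEquiv_quotient_zpowers ι.range
  let e' := (MonoidHom.ofInjective hι).trans e
  refine ⟨e'.symm.toMonoidHom.comp (QuotientGroup.mk' _), g,
    e'.symm.surjective.comp (QuotientGroup.mk'_surjective _), ?_⟩
  ext x
  simp

theorem CommGroup.exists_injective_of_ker_eq_zpowers {N : Type*} [CommGroup N] (f : G →* N)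
    (hf : Function.Surjective f) (g : G) (hg : f.ker = Subgroup.zpowers g) :
    ∃ (ι : N →* G) (q : G), Function.Injective ι ∧ ∀ x : G, ∃ s : N, ∃ k : ℤ, ι s * q ^ k = x := by
  obtain ⟨H, ⟨y, hy⟩, ⟨e⟩⟩ := exists_subgroup_mulEquiv_quotient_zpowers g
  obtain ⟨q, rfl⟩ := QuotientGroup.mk_surjective y
  let e' : H ≃* N := (e.trans (QuotientGroup.quotientMulEquivOfEq hg.symm)).trans
    (QuotientGroup.quotientKerEquivOfSurjective f hf)
  refine ⟨H.subtype.comp e'.symm.toMonoidHom, q,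
    H.subtype_injective.comp e'.symm.injective, fun x => ?_⟩
  obtain ⟨k, hk⟩ := hy x
  have hk' : ((q ^ k : G) : G ⧸ H) = x := hk
  rw [QuotientGroup.eq] at hk'
  exact ⟨e' ⟨_, hk'⟩, k, by simp⟩

end Duality

theorem AddCommGroup.exists_equiv_quotient_of_prod_int {T A : Type*} [AddCommGroup T]
    [AddCommGroup A] [Finite A] {t : T} {n : ℤ} (hn : n ≠ 0)
    (e : A ≃+ ((T × ℤ) ⧸ AddSubgroup.zmultiples (t, n))) :
    ∃ a : A, Nonempty (T ≃+ (A ⧸ AddSubgroup.zmultiples a)) := by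
  let π : T × ℤ →+ A := e.symm.toAddMonoidHom.comp (QuotientAddGroup.mk' _)
  have hπ : ∀ x, π x = 0 ↔ x ∈ AddSubgroup.zmultiples (t, n) := by simp [π]
  have hs : Function.Surjective π := e.symm.surjective.comp (QuotientAddGroup.mk'_surjective _)
  let ι : T →+ A := π.comp (AddMonoidHom.inl T ℤ)
  have hι : Function.Injective ι := by
    refine (injective_iff_map_eq_zero ι).2 fun s hs => ?_
    obtain ⟨k, hk⟩ := AddSubgroup.mem_zmultiples_iff.1 ((hπ _).1 hs)
    simp only [Prod.smul_mk, AddMonoidHom.inl_apply, Prod.mk.injEq, smul_eq_mul,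
      mul_eq_zero, hn, or_false] at hk
    simpa [hk.2] using hk.1.symm
  obtain ⟨f, g, hf, hg⟩ := CommGroup.exists_surjective_ker_eq_zpowers
    (AddMonoidHom.toMultiplicative ι) hι (.ofAdd (π (0, 1))) fun x => by
      obtain ⟨⟨s, k⟩, hx⟩ := hs x.toAdd
      refine ⟨.ofAdd s, k, ?_⟩
      change ι s + k • π (0, 1) = x.toAdd
      rw [← hx, ← map_zsmul, AddMonoidHom.comp_apply, ← map_add]
      simp
  let f' : A →+ T := AddMonoidHom.toMultiplicative.symm f
  have hf' : Function.Surjective f' := hf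
  have hk : f'.ker = AddSubgroup.zmultiples g.toAdd := by
    ext x
    exact SetLike.ext_iff.1 hg (.ofAdd x)
  exact ⟨g.toAdd, ⟨((QuotientAddGroup.quotientAddEquivOfEq hk.symm).trans
    (QuotientAddGroup.quotientKerEquivOfSurjective f' hf')).symm⟩⟩

theorem AddCommGroup.exists_equiv_prod_int_quotient {T A : Type*} [AddCommGroup T]
    [AddCommGroup A] [Finite A] {a : A} (e : T ≃+ (A ⧸ AddSubgroup.zmultiples a)) :
    ∃ (t : T) (m : ℕ), 0 < m ∧
      Nonempty (A ≃+ ((T × ℤ) ⧸ AddSubgroup.zmultiples (t, (m : ℤ)))) := by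
  let f : A →+ T := e.symm.toAddMonoidHom.comp (QuotientAddGroup.mk' _)
  have hf : Function.Surjective f := e.symm.surjective.comp (QuotientAddGroup.mk'_surjective _)
  obtain ⟨ι', q', hι', hq'⟩ := CommGroup.exists_injective_of_ker_eq_zpowers
    (AddMonoidHom.toMultiplicative f) hf (.ofAdd a) (by
      ext x
      change f x.toAdd = 0 ↔ x.toAdd ∈ AddSubgroup.zmultiples a
      simp [f])
  let ι : T →+ A := AddMonoidHom.toMultiplicative.symm ι'
  let q : A := q'.toAdd
  have hι : Function.Injective ι := hι'
  have hq : ∀ x : A, ∃ s : T, ∃ k : ℤ, ι s + k • q = x := hq'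
  let π : T × ℤ →+ A := ι.coprod (zmultiplesHom A q)
  have hπ : ∀ s k, π (s, k) = ι s + k • q := fun s k => by simp [π]
  have hs : Function.Surjective π := fun x => by
    obtain ⟨s, k, hx⟩ := hq x
    exact ⟨(s, k), by rw [hπ, hx]⟩
  obtain ⟨m, hm⟩ : ∃ m : ℕ, AddSubgroup.zmultiples (m : ℤ) = ι.range.comap (zmultiplesHom A q) := by
    obtain ⟨z, hz⟩ := Int.subgroup_cyclic (ι.range.comap (zmultiplesHom A q))
    refine ⟨z.natAbs, ?_⟩
    rw [Int.zmultiples_natAbs, hz, AddSubgroup.zmultiples_eq_closure]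
  have hm' : ∀ k : ℤ, (∃ j : ℤ, j * m = k) ↔ ∃ s, ι s = k • q := fun k => by
    have := SetLike.ext_iff.1 hm k
    simpa [AddSubgroup.mem_zmultiples_iff] using this
  have hpos : 0 < m := by
    obtain ⟨j, hj⟩ := (hm' (addOrderOf q)).2 ⟨0, by simp [addOrderOf_nsmul_eq_zero]⟩
    rcases Nat.eq_zero_or_pos m with rfl | h
    · have := addOrderOf_pos q
      simp at hj
      omega
    · exact h
  obtain ⟨s₀, hs₀⟩ := (hm' m).1 ⟨1, one_mul _⟩
  have hker : AddSubgroup.zmultiples (-s₀, (m : ℤ)) = π.ker := by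
    apply le_antisymm
    · rw [AddSubgroup.zmultiples_le, AddMonoidHom.mem_ker, hπ, map_neg, hs₀, neg_add_cancel]
    · rintro ⟨s, k⟩ hsk
      rw [AddMonoidHom.mem_ker, hπ] at hsk
      obtain ⟨j, rfl⟩ := (hm' k).2 ⟨-s, by rw [map_neg, neg_eq_of_add_eq_zero_right hsk]⟩
      refine AddSubgroup.mem_zmultiples_iff.2 ⟨j, ?_⟩
      have : ι (j • -s₀) = ι s := by
        rw [mul_smul, ← hs₀] at hsk
        rw [smul_neg, map_neg, map_zsmul, neg_eq_of_add_eq_zero_left hsk]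
      simp only [Prod.smul_mk, smul_eq_mul, hι this]
  exact ⟨-s₀, m, hpos, ⟨((QuotientAddGroup.quotientAddEquivOfEq hker).trans
    (QuotientAddGroup.quotientKerEquivOfSurjective π hs)).symm⟩⟩


/-- Let `T`, `T̃` be finite abelian groups and `n > 0`.  If there is `(t, n) ∈ T ⊕ ℤ` with
`T̃ ≅ (T ⊕ ℤ) ⧸ ⟨(t, n)⟩`, then there is `t̃ ∈ T̃` with `T ≅ T̃ ⧸ ⟨t̃⟩`, and such `t̃` is
unique up to automorphisms of `T̃`.  Conversely, if there is `t̃ ∈ T̃` with `T ≅ T̃ ⧸ ⟨t̃⟩`,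
then there are `t ∈ T` and an integer `m > 0` with `T̃ ≅ (T ⊕ ℤ) ⧸ ⟨(t, m)⟩`. -/
theorem stmt16 {T Tt : Type*} [AddCommGroup T] [AddCommGroup Tt] [Finite T] [Finite Tt]
    (n : ℕ) (hn : 0 < n) :
    ((∃ t : T, Nonempty (Tt ≃+ ((T × ℤ) ⧸ AddSubgroup.zmultiples ((t, (n : ℤ)) : T × ℤ)))) →
      ∃ tt : Tt, Nonempty (T ≃+ (Tt ⧸ AddSubgroup.zmultiples tt)) ∧
        ∀ tt' : Tt, Nonempty (T ≃+ (Tt ⧸ AddSubgroup.zmultiples tt')) →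
          ∃ e : Tt ≃+ Tt, e tt = tt') ∧
    ((∃ tt : Tt, Nonempty (T ≃+ (Tt ⧸ AddSubgroup.zmultiples tt))) →
      ∃ (t : T) (m : ℕ), 0 < m ∧
        Nonempty (Tt ≃+ ((T × ℤ) ⧸ AddSubgroup.zmultiples ((t, (m : ℤ)) : T × ℤ)))) := by
  refine ⟨fun ⟨t, ⟨e⟩⟩ => ?_, fun ⟨tt, ⟨e⟩⟩ => AddCommGroup.exists_equiv_prod_int_quotient e⟩
  obtain ⟨tt, ⟨f⟩⟩ :=
    AddCommGroup.exists_equiv_quotient_of_prod_int (Int.natCast_ne_zero.2 hn.ne') e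
  exact ⟨tt, ⟨f⟩, fun tt' ⟨f'⟩ =>
    AddEquiv.exists_apply_eq_of_quotient_zmultiples_equiv ⟨f.symm.trans f'⟩⟩
end

section
/- Let T be a finite abelian group. For every element u ∈ T ⊕ ℤ there exists an element v ∈ T ⊕ ℤ such that (T ⊕ ℤ)/⟨u, v⟩ ≅ T, where ⟨u, v⟩ is the subgroup generated by u and v. -/
/-- Duality of finite abelian groups exchanges subgroups and quotients: `G` has a quotient
isomorphic to `H` with kernel isomorphic to `G ⧸ H`. -/
theorem CommGroup.exists_surjective_ker_equiv_quotient {G : Type*} [CommGroup G] [Finite G]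
    (H : Subgroup G) :
    ∃ q : G →* H, Function.Surjective q ∧ Nonempty (q.ker ≃* G ⧸ H) := by
  obtain ⟨eG⟩ := CommGroup.monoidHom_mulEquiv_of_hasEnoughRootsOfUnity G ℂ
  obtain ⟨eH⟩ := CommGroup.monoidHom_mulEquiv_of_hasEnoughRootsOfUnity H ℂ
  obtain ⟨eQ⟩ := CommGroup.monoidHom_mulEquiv_of_hasEnoughRootsOfUnity (G ⧸ H) ℂ
  let r := MonoidHom.domRestrictHom H ℂˣ
  let q : G →* H := eH.toMonoidHom.comp (r.comp eG.symm.toMonoidHom)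
  have hker : r.ker.map eG.toMonoidHom = q.ker := by
    ext x
    simp [q, MonoidHom.mem_ker]
  refine ⟨q, eH.surjective.comp
    ((MonoidHom.domRestrict_surjective ℂ H).comp eG.symm.surjective), ⟨?_⟩⟩
  exact (MulEquiv.subgroupCongr hker).symm.trans
    ((eG.subgroupMap r.ker).symm.trans ((MonoidHom.domRestrictHomKerEquiv ℂˣ H).trans eQ))

/-- Additive version of `CommGroup.exists_surjective_ker_equiv_quotient`. -/
theorem AddCommGroup.exists_surjective_ker_equiv_quotient {E : Type*} [AddCommGroup E] [Finite E]
    (H : AddSubgroup E) :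
    ∃ q : E →+ H, Function.Surjective q ∧ Nonempty (q.ker ≃+ E ⧸ H) := by
  obtain ⟨q, hq, ⟨e⟩⟩ :=
    CommGroup.exists_surjective_ker_equiv_quotient (G := Multiplicative E) H.toSubgroup
  exact ⟨AddMonoidHom.mk' (fun x => q x) (map_mul q), hq,
    ⟨AddEquiv.mk' (⟨fun x => e x, fun x => e.symm x, e.left_inv, e.right_inv⟩) (map_mul e)⟩⟩

/-- A surjection with kernel generated by `u` and `v` identifies the quotient by `⟨u, v⟩`. -/
theorem nonempty_quotient_closure_pair_equiv {G T : Type*} [AddCommGroup G] [AddCommGroup T]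
    {u v : G} (g : G →+ T) (hg : Function.Surjective g)
    (hker : ∀ x, g x = 0 ↔ ∃ m n : ℤ, m • u + n • v = x) :
    Nonempty ((G ⧸ AddSubgroup.closure {u, v}) ≃+ T) := by
  have h : AddSubgroup.closure {u, v} = g.ker := by
    ext x
    rw [AddSubgroup.mem_closure_pair, AddMonoidHom.mem_ker, hker]
  exact ⟨(QuotientAddGroup.quotientAddEquivOfEq h).trans
    (QuotientAddGroup.quotientKerEquivOfSurjective g hg)⟩

theorem exists_quotient_closure_pair_equiv_of_snd_eq_zero {T : Type*} [AddCommGroup T] [Finite T]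
    (t : T) :
    ∃ v : T × ℤ,
      Nonempty (((T × ℤ) ⧸ AddSubgroup.closure {((t, 0) : T × ℤ), v}) ≃+ T) := by
  obtain ⟨q, hq, ⟨e⟩⟩ :=
    AddCommGroup.exists_surjective_ker_equiv_quotient (AddSubgroup.zmultiples t)
  obtain ⟨x, hx⟩ := hq ⟨t, AddSubgroup.mem_zmultiples t⟩
  let f : T →+ T := q.ker.subtype.comp (e.symm.toAddMonoidHom.comp (QuotientAddGroup.mk' _))
  have hf_zero (s : T) : f s = 0 ↔ ∃ m : ℤ, m • t = s := by
    simp [f, AddSubgroup.mem_zmultiples_iff]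
  have hf_range (y : T) (hy : q y = 0) : ∃ s, f s = y := by
    obtain ⟨s, hs⟩ := QuotientAddGroup.mk_surjective (e ⟨y, hy⟩)
    exact ⟨s, by simp [f, hs]⟩
  let g : T × ℤ →+ T := f.coprod (zmultiplesHom T x)
  have hg_apply (s : T) (k : ℤ) : g (s, k) = f s + k • x := by simp [g]
  have hg : Function.Surjective g := by
    intro y
    obtain ⟨k, hk⟩ := AddSubgroup.mem_zmultiples_iff.mp (q y).2
    obtain ⟨s, hs⟩ := hf_range (y - k • x) (by
      rw [map_sub, map_zsmul, hx, sub_eq_zero]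
      exact Subtype.ext (by simpa using hk.symm))
    exact ⟨(s, k), by rw [hg_apply, hs, sub_add_cancel]⟩
  obtain ⟨m, hm⟩ := (AddSubgroup.isAddCyclic_iff_exists_zmultiples_eq_top
    (g.ker.map (AddMonoidHom.snd T ℤ))).mp inferInstance
  obtain ⟨v, hv, hvm⟩ : m ∈ g.ker.map (AddMonoidHom.snd T ℤ) :=
    hm ▸ AddSubgroup.mem_zmultiples m
  have hgt : g (t, 0) = 0 := by
    rw [hg_apply, (hf_zero t).mpr ⟨1, one_zsmul t⟩, zero_smul, add_zero]
  refine ⟨v, nonempty_quotient_closure_pair_equiv g hg fun y => ⟨fun hy => ?_, ?_⟩⟩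
  · obtain ⟨j, hj⟩ : ∃ j : ℤ, j • m = y.2 :=
      AddSubgroup.mem_zmultiples_iff.mp (hm ▸ ⟨y, hy, rfl⟩)
    have hj' : (y - j • v).2 = 0 := by
      have : v.2 = m := hvm
      simp [this, ← hj]
    have h0 : g (y - j • v) = 0 := by
      rw [map_sub, map_zsmul, hy, show g v = 0 from hv, smul_zero, sub_zero]
    rw [← Prod.mk.eta (p := y - j • v), hj', hg_apply, zero_smul, add_zero, hf_zero] at h0
    obtain ⟨i, hi⟩ := h0
    refine ⟨i, j, ?_⟩
    rw [← eq_sub_iff_add_eq]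
    exact Prod.ext (by simpa using hi) (by simpa using hj'.symm)
  · rintro ⟨i, j, rfl⟩
    rw [map_add, map_zsmul, map_zsmul, hgt, show g v = 0 from hv, smul_zero, smul_zero, add_zero]

theorem finite_quotient_zmultiples_of_snd_ne_zero {T : Type*} [AddCommGroup T] [Finite T]
    {u : T × ℤ} (hu : u.2 ≠ 0) : Finite ((T × ℤ) ⧸ AddSubgroup.zmultiples u) := by
  have : NeZero u.2.natAbs := ⟨Int.natAbs_ne_zero.mpr hu⟩
  refine Finite.of_surjective (α := T × Set.Ico 0 |u.2|)
    (fun p => ((p.1, (p.2 : ℤ)) : T × ℤ)) fun y => ?_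
  obtain ⟨⟨s, k⟩, rfl⟩ := QuotientAddGroup.mk_surjective y
  refine ⟨(s - (k / u.2) • u.1, ⟨k % u.2, Int.emod_nonneg _ hu, Int.emod_lt_abs _ hu⟩), ?_⟩
  rw [QuotientAddGroup.eq, AddSubgroup.mem_zmultiples_iff]
  refine ⟨k / u.2, Prod.ext (by simp) ?_⟩
  have := Int.mul_ediv_add_emod k u.2
  simp only [Prod.smul_snd, smul_eq_mul, Prod.snd_add, Prod.snd_neg]
  linarith

theorem exists_quotient_closure_pair_equiv_of_snd_ne_zero {T : Type*} [AddCommGroup T] [Finite T]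
    {u : T × ℤ} (hu : u.2 ≠ 0) :
    ∃ v : T × ℤ, Nonempty (((T × ℤ) ⧸ AddSubgroup.closure {u, v}) ≃+ T) := by
  have := finite_quotient_zmultiples_of_snd_ne_zero hu
  let π := QuotientAddGroup.mk' (AddSubgroup.zmultiples u)
  let i := π.comp (AddMonoidHom.inl T ℤ)
  have hi : Function.Injective i := by
    rw [injective_iff_map_eq_zero]
    intro s hs
    obtain ⟨k, hk⟩ := AddSubgroup.mem_zmultiples_iff.mp ((QuotientAddGroup.eq_zero_iff _).mp hs)
    have hk2 : k * u.2 = 0 := by simpa using congrArg Prod.snd hk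
    have hk0 : k = 0 := (mul_eq_zero.mp hk2).resolve_right hu
    simpa [hk0] using (congrArg Prod.fst hk).symm
  obtain ⟨q, hq, ⟨e⟩⟩ := AddCommGroup.exists_surjective_ker_equiv_quotient i.range
  have hcyc : IsAddCyclic (((T × ℤ) ⧸ AddSubgroup.zmultiples u) ⧸ i.range) := by
    refine isAddCyclic_of_surjective
      ((QuotientAddGroup.mk' i.range).comp (π.comp (AddMonoidHom.inr T ℤ))) fun y => ?_
    obtain ⟨y, rfl⟩ := QuotientAddGroup.mk_surjective y
    obtain ⟨⟨s, k⟩, rfl⟩ := QuotientAddGroup.mk_surjective y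
    refine ⟨k, QuotientAddGroup.eq.mpr ⟨s, ?_⟩⟩
    change π (s, 0) = -π (0, k) + π (s, k)
    rw [← map_neg, ← map_add]
    simp
  have := isAddCyclic_of_surjective e.symm e.symm.surjective
  obtain ⟨c, hc⟩ := (AddSubgroup.isAddCyclic_iff_exists_zmultiples_eq_top q.ker).mp this
  obtain ⟨v, rfl⟩ := QuotientAddGroup.mk_surjective c
  let ι := AddMonoidHom.ofInjective hi
  refine ⟨v, nonempty_quotient_closure_pair_equiv (ι.symm.toAddMonoidHom.comp (q.comp π))
    (ι.symm.surjective.comp (hq.comp (QuotientAddGroup.mk'_surjective _))) fun x => ?_⟩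
  calc _ ↔ π x ∈ q.ker := by simp [AddMonoidHom.mem_ker]
    _ ↔ ∃ n : ℤ, π (n • v) = π x := by
      rw [← hc, AddSubgroup.mem_zmultiples_iff]
      rfl
    _ ↔ ∃ n m : ℤ, m • u + n • v = x := by
      refine exists_congr fun n => ?_
      refine QuotientAddGroup.eq.trans (AddSubgroup.mem_zmultiples_iff.trans ?_)
      refine exists_congr fun m => ?_
      rw [eq_neg_add_iff_add_eq, add_comm]
    _ ↔ _ := exists_comm

/-- For a finite abelian group `T` and any `u ∈ T ⊕ ℤ` there is `v ∈ T ⊕ ℤ` such that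
`(T ⊕ ℤ) ⧸ ⟨u, v⟩ ≅ T`. -/
theorem stmt17 {T : Type*} [AddCommGroup T] [Finite T] (u : T × ℤ) :
    ∃ v : T × ℤ,
      Nonempty (((T × ℤ) ⧸ AddSubgroup.closure {u, v}) ≃+ T) := by
  obtain ⟨t, n⟩ := u
  by_cases hn : n = 0
  · subst hn
    exact exists_quotient_closure_pair_equiv_of_snd_eq_zero t
  · exact exists_quotient_closure_pair_equiv_of_snd_ne_zero hn
end
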